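/- arXiv:math/0603188 — 3 statements merged into one kernel-verified Lean document; each statement's English description precedes it below -/
import Mathlib

section
/- Every infinite-dimensional Banach space contains an infinite-dimensional closed subspace Y such that either Y has an unconditional Schauder basis, or Y is hereditarily indecomposable. These two alternatives are mutually exclusive for a given Y. -/
open Filter Topology

noncomputable section

/-- Two subspaces `U`, `V` form a topological direct sum: trivial intersection, closed sum,
and the projection from `U + V` onto `U` along `V` is bounded. -/
def IsTopDirectSum {E : Type*} [SeminormedAddCommGroup E] [NormedSpace ℝ E]
    (U V : Submodule ℝ E) : Prop :=
  U ⊓ V = ⊥ ∧ IsClosed ((U ⊔ V : Submodule ℝ E) : Set E) ∧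
    ∃ C : ℝ, ∀ u ∈ U, ∀ v ∈ V, ‖u‖ ≤ C * ‖u + v‖

/-- A Banach space is decomposable if it is the topological direct sum of two
infinite-dimensional closed subspaces. -/
def Decomposable (E : Type*) [SeminormedAddCommGroup E] [NormedSpace ℝ E] : Prop :=
  ∃ U V : Submodule ℝ E, IsClosed (U : Set E) ∧ IsClosed (V : Set E) ∧
    ¬FiniteDimensional ℝ U ∧ ¬FiniteDimensional ℝ V ∧ U ⊔ V = ⊤ ∧ IsTopDirectSum U V

/-- An infinite-dimensional space is hereditarily indecomposable (HI) when no closed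
subspace of it is decomposable. -/
def IsHI (E : Type*) [SeminormedAddCommGroup E] [NormedSpace ℝ E] : Prop :=
  ¬FiniteDimensional ℝ E ∧
    ∀ Y : Submodule ℝ E, IsClosed (Y : Set E) → ¬ Decomposable ↥Y

/-- A Schauder basis: every vector has a unique norm-convergent expansion. -/
def IsSchauderBasis {E : Type*} [SeminormedAddCommGroup E] [NormedSpace ℝ E]
    (e : ℕ → E) : Prop :=
  ∀ x : E, ∃! c : ℕ → ℝ,
    Tendsto (fun N => ∑ n ∈ Finset.range N, c n • e n) atTop (𝓝 x)

/-- A `C`-unconditional Schauder basis. -/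
def IsUnconditionalSchauderBasis {E : Type*} [SeminormedAddCommGroup E] [NormedSpace ℝ E]
    (C : ℝ) (e : ℕ → E) : Prop :=
  IsSchauderBasis e ∧ 1 ≤ C ∧
    ∀ (c : ℕ → ℝ) (x : E),
      Tendsto (fun N => ∑ n ∈ Finset.range N, c n • e n) atTop (𝓝 x) →
      ∀ ε : ℕ → ℝ, (∀ n, ε n = 1 ∨ ε n = -1) →
        ∃ y : E, Tendsto (fun N => ∑ n ∈ Finset.range N, (ε n * c n) • e n) atTop (𝓝 y) ∧
          ‖y‖ ≤ C * ‖x‖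

section Subspaces

variable {X : Type*} [NormedAddCommGroup X] [NormedSpace ℝ X]

/-- A closed infinite-dimensional subspace. -/
def ClosedInfDim (Y : Submodule ℝ X) : Prop := IsClosed (Y : Set X) ∧ ¬Y.FG

lemma ClosedInfDim.inf_of_le_sup {Y T F : Submodule ℝ X} (hY : ClosedInfDim Y)
    (hT : IsClosed (T : Set X)) (hF : F.FG) (h : Y ≤ T ⊔ F) : ClosedInfDim (Y ⊓ T) := by
  refine ⟨hY.1.inter hT, fun hfg => hY.2 ?_⟩
  refine Submodule.fg_of_fg_map_of_fg_inf_ker T.mkQ ?_ (by simpa using hfg)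
  refine Submodule.FG.of_le (hF.map T.mkQ) ?_
  calc Y.map T.mkQ ≤ (T ⊔ F).map T.mkQ := Submodule.map_mono h
    _ = F.map T.mkQ := by simp [Submodule.map_sup]

lemma ClosedInfDim.inf_ker {Y : Submodule ℝ X} (hY : ClosedInfDim Y) (f : X →L[ℝ] ℝ) :
    ClosedInfDim (Y ⊓ LinearMap.ker (f : X →ₗ[ℝ] ℝ)) := by
  refine ⟨hY.1.inter f.isClosed_ker, fun hfg => hY.2 ?_⟩
  exact Submodule.fg_of_fg_map_of_fg_inf_ker (f : X →ₗ[ℝ] ℝ) (IsNoetherian.noetherian _) hfg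

lemma ClosedInfDim.exists_mem_forall_eq_zero {Y : Submodule ℝ X} (hY : ClosedInfDim Y)
    (f : ℕ → X →L[ℝ] ℝ) (n : ℕ) :
    ∃ v ∈ Y, v ≠ 0 ∧ ∀ i < n, f i v = 0 := by
  have key : ∀ n, ∃ Z ≤ Y, ClosedInfDim Z ∧ ∀ v ∈ Z, ∀ i < n, f i v = 0 := by
    intro n
    induction n with
    | zero => exact ⟨Y, le_rfl, hY, by simp⟩
    | succ n ih =>
      obtain ⟨Z, hZY, hZ, h⟩ := ih
      refine ⟨_, inf_le_left.trans hZY, hZ.inf_ker (f n), fun v hv i hi => ?_⟩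
      rcases Nat.lt_succ_iff_lt_or_eq.1 hi with hi | rfl
      · exact h v hv.1 i hi
      · simpa using hv.2
  obtain ⟨Z, hZY, hZ, h⟩ := key n
  obtain ⟨v, hv, hv0⟩ := Submodule.exists_mem_ne_zero_of_ne_bot
    (p := Z) (fun h0 => hZ.2 (h0 ▸ Submodule.fg_bot))
  exact ⟨v, hZY hv, hv0, h v hv⟩

/-- A sequence can be built term by term, each term depending on all the previous ones. -/
lemma exists_seq_of_forall_extend {α : Type*} [Nonempty α] (I : ℕ → (ℕ → α) → Prop)
    (hloc : ∀ n a b, (∀ i < n, a i = b i) → I n a → I n b) (h0 : ∀ a, I 0 a)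
    (hs : ∀ n a, I n a → ∃ x, I (n + 1) (Function.update a n x)) : ∃ a, ∀ n, I n a := by
  choose! x hx using hs
  let g : ℕ → ℕ → α := fun n =>
    Nat.rec (fun _ => Classical.arbitrary α) (fun n a => Function.update a n (x n a)) n
  have hg : ∀ n, g (n + 1) = Function.update (g n) n (x n (g n)) := fun n => rfl
  have hI : ∀ n, I n (g n) := by
    intro n
    induction n with
    | zero => exact h0 _
    | succ n ih => rw [hg]; exact hx n _ ih
  have hst : ∀ n i, i < n → g n i = g (i + 1) i := by
    intro n
    induction n with
    | zero => simp
    | succ n ih =>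
      intro i hi
      rcases Nat.lt_succ_iff_lt_or_eq.1 hi with hi | rfl
      · rw [hg, Function.update_of_ne hi.ne, ih i hi]
      · rfl
  exact ⟨fun i => g (i + 1) i, fun n => hloc n _ _ (hst n) (hI n)⟩

lemma exists_diagonal_subspace (M : ℕ → Submodule ℝ X) (hM : Antitone M)
    (hbig : ∀ n, ClosedInfDim (M n)) :
    ∃ N ≤ M 0, ClosedInfDim N ∧ TopologicalSpace.IsSeparable (N : Set X) ∧
      ∀ Y ≤ N, ClosedInfDim Y → ∀ n, ClosedInfDim (Y ⊓ M n) := by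
  obtain ⟨v, hv⟩ := exists_seq_of_forall_extend (α := X)
    (fun n a => ∀ i < n, a i ∈ M i ∧ a i ∉ Submodule.span ℝ (a '' Set.Iio i))
    (by
      intro n a b hab h i hi
      have : a '' Set.Iio i = b '' Set.Iio i :=
        Set.image_congr fun j hj => hab j (lt_trans hj hi)
      rw [← hab i hi, ← this]
      exact h i hi)
    (by simp)
    (by
      intro n a h
      have hfg : (Submodule.span ℝ (a '' Set.Iio n)).FG :=
        Submodule.fg_span ((Set.finite_Iio n).image a)
      obtain ⟨x, hxM, hx⟩ := SetLike.not_le_iff_exists.1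
        (fun hle => (hbig n).2 (Submodule.FG.of_le hfg hle))
      refine ⟨x, fun i hi => ?_⟩
      have him : ∀ i ≤ n, Function.update a n x '' Set.Iio i = a '' Set.Iio i := fun i hi =>
        Set.image_congr fun j hj => Function.update_of_ne (lt_of_lt_of_le hj hi).ne _ _
      rcases Nat.lt_succ_iff_lt_or_eq.1 hi with hi | rfl
      · rw [him i hi.le, Function.update_of_ne hi.ne]
        exact h i hi
      · rw [him i le_rfl, Function.update_self]
        exact ⟨hxM, hx⟩)
  replace hv : ∀ i, v i ∈ M i ∧ v i ∉ Submodule.span ℝ (v '' Set.Iio i) :=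
    fun i => hv (i + 1) i (Nat.lt_succ_self i)
  let N : Submodule ℝ X := (Submodule.span ℝ (Set.range v)).topologicalClosure
  have hvN : ∀ i, v i ∈ N := fun i =>
    Submodule.le_topologicalClosure _ (Submodule.subset_span ⟨i, rfl⟩)
  have hNM : ∀ n, N ≤ M n ⊔ Submodule.span ℝ (v '' Set.Iio n) := by
    intro n
    have hfg : (Submodule.span ℝ (v '' Set.Iio n)).FG :=
      Submodule.fg_span ((Set.finite_Iio n).image v)
    have := (Submodule.fg_iff_finiteDimensional _).1 hfg
    refine Submodule.topologicalClosure_minimal _ ?_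
      (Submodule.isClosed_sup_finiteDimensional _ _ (hbig n).1)
    rw [Submodule.span_le]
    rintro _ ⟨k, rfl⟩
    rcases lt_or_ge k n with hk | hk
    · exact Submodule.mem_sup_right (Submodule.subset_span ⟨k, hk, rfl⟩)
    · exact Submodule.mem_sup_left (hM hk (hv k).1)
  refine ⟨N, ?_, ⟨Submodule.isClosed_topologicalClosure _, fun hfg => ?_⟩, ?_, ?_⟩
  · simpa using hNM 0
  · have := (Submodule.fg_iff_finiteDimensional _).1 hfg
    have hmono : StrictMono fun n =>
        (Submodule.span ℝ (v '' Set.Iio n)).comap N.subtype := by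
      refine strictMono_nat_of_lt_succ fun n => lt_of_le_of_ne ?_ fun heq => (hv n).2 ?_
      · exact Submodule.comap_mono (Submodule.span_mono (Set.image_mono
          (Set.Iio_subset_Iio n.le_succ)))
      · have : (⟨v n, hvN n⟩ : N) ∈ (Submodule.span ℝ (v '' Set.Iio (n + 1))).comap N.subtype :=
          Submodule.subset_span ⟨n, Nat.lt_succ_self n, rfl⟩
        rw [← heq] at this
        exact this
    exact not_strictMono_of_wellFoundedGT _ hmono
  · exact ((Set.countable_range v).isSeparable.span (R := ℝ)).closure
  · intro Y hYN hY n
    exact hY.inf_of_le_sup (hbig n).1 (Submodule.fg_span ((Set.finite_Iio n).image v))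
      (hYN.trans (hNM n))

end Subspaces

section Acceptance

variable {X : Type*} [NormedAddCommGroup X] [NormedSpace ℝ X]

/-- `M` accepts the pair `(s, d)` at level `δ` when any two closed infinite-dimensional subspaces
of `M` contain `y` and `z` for which `d + y - z` is shorter, by the margin `δ`, than
`ε` times `s + y + z`. -/
def Accepts (ε : ℝ) (M : Submodule ℝ X) (p : X × X) (δ : ℝ) : Prop :=
  ∀ Y Z, ClosedInfDim Y → ClosedInfDim Z → Y ≤ M → Z ≤ M →
    ∃ y ∈ Y, ∃ z ∈ Z, ‖p.2 + y - z‖ + δ < ε * ‖p.1 + y + z‖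

lemma Accepts.mono {ε δ : ℝ} {M N : Submodule ℝ X} {p : X × X} (h : Accepts ε M p δ)
    (hNM : N ≤ M) : Accepts ε N p δ :=
  fun Y Z hY hZ hYN hZN => h Y Z hY hZ (hYN.trans hNM) (hZN.trans hNM)

lemma Accepts.perturb {ε δ δ' : ℝ} (hε : 0 ≤ ε) {M : Submodule ℝ X} {p q : X × X}
    (h : Accepts ε M p δ') (hpq : (1 + ε) * dist p q + δ ≤ δ') : Accepts ε M q δ := by
  intro Y Z hY hZ hYM hZM
  obtain ⟨y, hy, z, hz, hyz⟩ := h Y Z hY hZ hYM hZM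
  refine ⟨y, hy, z, hz, ?_⟩
  have h1 : ‖p.1 + y + z‖ ≤ ‖q.1 + y + z‖ + dist p q := by
    calc ‖p.1 + y + z‖ = ‖(q.1 + y + z) + (p.1 - q.1)‖ := by congr 1; abel
      _ ≤ _ := norm_add_le _ _
      _ ≤ _ := by rw [← dist_eq_norm p.1]; gcongr; exact le_max_left _ _
  have h2 : ‖q.2 + y - z‖ ≤ ‖p.2 + y - z‖ + dist p q := by
    calc ‖q.2 + y - z‖ = ‖(p.2 + y - z) - (p.2 - q.2)‖ := by congr 1; abel
      _ ≤ _ := norm_sub_le _ _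
      _ ≤ _ := by rw [← dist_eq_norm p.2]; gcongr; exact le_max_right _ _
  have h3 := mul_le_mul_of_nonneg_left h1 hε
  linarith

/-- A subspace is stable when passing to smaller subspaces does not make any pair of its vectors
accepted that was not accepted before, up to an arbitrarily small change of level. -/
def AcceptStable (ε : ℝ) (M : Submodule ℝ X) : Prop :=
  ∀ p : X × X, p.1 ∈ M → p.2 ∈ M → ∀ δ δ', δ < δ' → ¬Accepts ε M p δ →
    ∀ N ≤ M, ClosedInfDim N → ¬Accepts ε N p δ'

lemma exists_decided_subspace (ε : ℝ) {M : Submodule ℝ X} (hM : ClosedInfDim M)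
    (q : ℕ → (X × X) × ℝ) :
    ∃ N ≤ M, ClosedInfDim N ∧ ∀ n, Accepts ε N (q n).1 (q n).2 ∨
      ∀ L ≤ N, ClosedInfDim L → ¬Accepts ε L (q n).1 (q n).2 := by
  have step : ∀ (L : {L : Submodule ℝ X // ClosedInfDim L}) (n : ℕ),
      ∃ L' : {L : Submodule ℝ X // ClosedInfDim L}, L'.1 ≤ L.1 ∧
        (Accepts ε L'.1 (q n).1 (q n).2 ∨
          ∀ K ≤ L'.1, ClosedInfDim K → ¬Accepts ε K (q n).1 (q n).2) := by
    intro L n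
    by_cases h : ∃ K ≤ L.1, ClosedInfDim K ∧ Accepts ε K (q n).1 (q n).2
    · obtain ⟨K, hKL, hK, hacc⟩ := h
      exact ⟨⟨K, hK⟩, hKL, Or.inl hacc⟩
    · push Not at h
      exact ⟨L, le_rfl, Or.inr h⟩
  choose g hgle hg using step
  let S : ℕ → {L : Submodule ℝ X // ClosedInfDim L} := fun n => Nat.rec ⟨M, hM⟩ (fun n L => g L n) n
  have hS : ∀ n, S (n + 1) = g (S n) n := fun n => rfl
  obtain ⟨N, hNM, hN, -, hdiag⟩ := exists_diagonal_subspace (fun n => (S n).1)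
    (antitone_nat_of_succ_le fun n => hgle _ _) (fun n => (S n).2)
  refine ⟨N, hNM, hN, fun n => ?_⟩
  rcases hg (S n) n with h | h
  · left
    intro Y Z hY hZ hYN hZN
    obtain ⟨y, hy, z, hz, hyz⟩ := h _ _ (hdiag Y hYN hY (n + 1)) (hdiag Z hZN hZ (n + 1))
      inf_le_right inf_le_right
    exact ⟨y, hy.1, z, hz.1, hyz⟩
  · right
    intro L hLN hL hacc
    exact h _ inf_le_right (hdiag L hLN hL (n + 1)) (hacc.mono inf_le_left)

lemma exists_acceptStable {ε : ℝ} (hε : 0 ≤ ε) {M : Submodule ℝ X} (hM : ClosedInfDim M)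
    (hsep : TopologicalSpace.IsSeparable (M : Set X)) :
    ∃ N ≤ M, ClosedInfDim N ∧ AcceptStable ε N := by
  have hs : TopologicalSpace.SeparableSpace M := hsep.separableSpace
  let D : (ℕ × ℕ) × ℚ → (X × X) × ℝ := fun t =>
    (((TopologicalSpace.denseSeq M t.1.1 : M), (TopologicalSpace.denseSeq M t.1.2 : M)), t.2)
  obtain ⟨c, hc⟩ := exists_surjective_nat ((ℕ × ℕ) × ℚ)
  obtain ⟨N, hNM, hN, hdec⟩ := exists_decided_subspace ε hM (D ∘ c)
  refine ⟨N, hNM, hN, fun p hp1 hp2 δ δ' hδ hnot L hLN hL hacc => hnot ?_⟩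
  obtain ⟨r, hr1, hr2⟩ := exists_rat_btwn hδ
  obtain ⟨η, hη, hη1, hη2⟩ : ∃ η > 0, (1 + ε) * η + δ ≤ r ∧ (1 + ε) * η + r ≤ δ' := by
    have hpos : 0 < 1 + ε := by linarith
    have hm : 0 < min ((r : ℝ) - δ) (δ' - r) := lt_min (by linarith) (by linarith)
    refine ⟨min ((r : ℝ) - δ) (δ' - r) / (1 + ε), div_pos hm hpos, ?_, ?_⟩ <;>
      rw [mul_div_cancel₀ _ hpos.ne']
    · linarith [min_le_left ((r : ℝ) - δ) (δ' - r)]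
    · linarith [min_le_right ((r : ℝ) - δ) (δ' - r)]
  obtain ⟨i, hi⟩ := (TopologicalSpace.denseRange_denseSeq M).exists_dist_lt
    (⟨p.1, hNM hp1⟩ : M) hη
  obtain ⟨j, hj⟩ := (TopologicalSpace.denseRange_denseSeq M).exists_dist_lt
    (⟨p.2, hNM hp2⟩ : M) hη
  obtain ⟨n, hn⟩ := hc ((i, j), r)
  have hdist : dist p (D ((i, j), r)).1 ≤ η := max_le hi.le hj.le
  have hdist' : dist (D ((i, j), r)).1 p ≤ η := by rwa [dist_comm]
  have hpos : 0 ≤ 1 + ε := by linarith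
  have hL' : Accepts ε L (D ((i, j), r)).1 r :=
    hacc.perturb hε (by linarith [mul_le_mul_of_nonneg_left hdist hpos])
  have := hdec n
  simp only [Function.comp, hn] at this
  exact (this.resolve_right fun h => h L hLN hL hL').perturb hε
    (by linarith [mul_le_mul_of_nonneg_left hdist' hpos])

lemma AcceptStable.exists_forall_not_accepts {ε : ℝ} {M N : Submodule ℝ X}
    (hM : AcceptStable ε M) (hNM : N ≤ M) (hN : ClosedInfDim N) {p : X × X}
    (hp1 : p.1 ∈ M) (hp2 : p.2 ∈ M) {δ δ' : ℝ} (hδ : δ < δ') (hp : ¬Accepts ε M p δ) :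
    ∃ L ≤ N, ClosedInfDim L ∧ ∀ u ∈ L,
      ¬Accepts ε M (p + (u, u)) δ' ∧ ¬Accepts ε M (p + (u, -u)) δ' := by
  have hsplit : ∀ N ≤ M, ClosedInfDim N → ∃ Y Z, ClosedInfDim Y ∧ ClosedInfDim Z ∧ Y ≤ N ∧
      Z ≤ N ∧ ∀ y ∈ Y, ∀ z ∈ Z, ¬(‖p.2 + y - z‖ + δ' < ε * ‖p.1 + y + z‖) := by
    intro N hNM hN
    have := hM p hp1 hp2 δ δ' hδ hp N hNM hN
    unfold Accepts at this
    push Not at this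
    obtain ⟨Y, Z, hY, hZ, hYN, hZN, h⟩ := this
    exact ⟨Y, Z, hY, hZ, hYN, hZN, fun y hy z hz => (h y hy z hz).not_gt⟩
  obtain ⟨Y, Z, hY, hZ, hYN, hZN, h⟩ := hsplit N hNM hN
  obtain ⟨Y', Z', hY', hZ', hYN', hZN', h'⟩ := hsplit Y (hYN.trans hNM) hY
  refine ⟨Z', hZN'.trans hYN, hZ', fun u hu => ⟨fun hacc => ?_, fun hacc => ?_⟩⟩
  · obtain ⟨y, hy, z, hz, hyz⟩ := hacc Y Z hY hZ (hYN.trans hNM) (hZN.trans hNM)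
    refine h (u + y) (Y.add_mem (hZN' hu) hy) z hz ?_
    simpa [add_assoc] using hyz
  · obtain ⟨y, hy, z, hz, hyz⟩ := hacc Y' Z' hY' hZ' (hYN'.trans (hYN.trans hNM))
      (hZN'.trans (hYN.trans hNM))
    refine h' y hy (u + z) (Z'.add_mem hu hz) ?_
    convert hyz using 3
    · simp only [Prod.snd_add]; abel_nf
    · simp only [Prod.fst_add]; abel_nf

lemma AcceptStable.exists_forall_not_accepts_of_isCompact {ε : ℝ} (hε : 0 ≤ ε)
    {M : Submodule ℝ X} (hM : AcceptStable ε M) (hbig : ClosedInfDim M) {K : Set (X × X)}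
    (hK : IsCompact K) (hKM : ∀ p ∈ K, p.1 ∈ M ∧ p.2 ∈ M) {δ δ' : ℝ} (hδ : δ < δ')
    (hp : ∀ p ∈ K, ¬Accepts ε M p δ) :
    ∃ L ≤ M, ClosedInfDim L ∧ ∀ u ∈ L, ∀ p ∈ K,
      ¬Accepts ε M (p + (u, u)) δ' ∧ ¬Accepts ε M (p + (u, -u)) δ' := by
  have hpos : 0 < 1 + ε := by linarith
  have hη : 0 < (δ' - δ) / 2 / (1 + ε) := div_pos (by linarith) hpos
  obtain ⟨t, htK, htfin, hcov⟩ := hK.finite_cover_balls hη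
  have hmid : δ < (δ + δ') / 2 := by linarith
  have key : ∃ L ≤ M, ClosedInfDim L ∧ ∀ p ∈ t, ∀ u ∈ L,
      ¬Accepts ε M (p + (u, u)) ((δ + δ') / 2) ∧ ¬Accepts ε M (p + (u, -u)) ((δ + δ') / 2) := by
    clear hcov
    induction t, htfin using Set.Finite.induction_on with
    | empty => exact ⟨M, le_rfl, hbig, by simp⟩
    | @insert a s _ _ ih =>
      have haK := htK (Set.mem_insert a s)
      obtain ⟨L, hLM, hL, h⟩ := ih ((Set.subset_insert a s).trans htK)
      obtain ⟨L', hLL', hL', h'⟩ := hM.exists_forall_not_accepts hLM hL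
        (hKM a haK).1 (hKM a haK).2 hmid (hp a haK)
      refine ⟨L', hLL'.trans hLM, hL', ?_⟩
      rintro p (rfl | hps) u hu
      · exact h' u hu
      · exact h p hps u (hLL' hu)
  obtain ⟨L, hLM, hL, h⟩ := key
  refine ⟨L, hLM, hL, fun u hu p hpK => ?_⟩
  obtain ⟨q, hqt, hpq⟩ := Set.mem_iUnion₂.1 (hcov hpK)
  have hbound : ∀ w : X × X, (1 + ε) * dist (p + w) (q + w) + (δ + δ') / 2 ≤ δ' := by
    intro w
    rw [dist_add_right]
    have := mul_le_mul_of_nonneg_left (Metric.mem_ball.1 hpq).le hpos.le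
    rw [mul_div_cancel₀ _ hpos.ne'] at this
    linarith
  exact ⟨fun hacc => (h q hqt u hu).1 (hacc.perturb hε (hbound _)),
    fun hacc => (h q hqt u hu).2 (hacc.perturb hε (hbound _))⟩

end Acceptance

section Construction

variable {X : Type*} [NormedAddCommGroup X] [NormedSpace ℝ X]

lemma AcceptStable.exists_extend {ε : ℝ} (hε : 0 ≤ ε) {M : Submodule ℝ X}
    (hM : AcceptStable ε M) (hbig : ClosedInfDim M) {δ δ' : ℝ} (hδ : δ < δ') (n : ℕ)
    (e : ℕ → X) (f : ℕ → X →L[ℝ] ℝ) (heM : ∀ i < n, e i ∈ M)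
    (hef : ∀ i < n, ∀ j < n, f i (e j) = if i = j then 1 else 0)
    (hacc : ∀ c σ : ℕ → ℝ, (∀ i < n, |c i| ≤ ‖f i‖) → (∀ i < n, σ i = 1 ∨ σ i = -1) →
      ¬Accepts ε M (∑ i ∈ Finset.range n, c i • e i, ∑ i ∈ Finset.range n, (σ i * c i) • e i) δ) :
    ∃ v ∈ M, ∃ g : X →L[ℝ] ℝ, g v = 1 ∧ (∀ i < n, f i v = 0) ∧ (∀ i < n, g (e i) = 0) ∧
      ∀ c σ : ℕ → ℝ, (∀ i < n, |c i| ≤ ‖f i‖) → (∀ i < n + 1, σ i = 1 ∨ σ i = -1) →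
      ¬Accepts ε M (∑ i ∈ Finset.range n, c i • e i + c n • v,
        ∑ i ∈ Finset.range n, (σ i * c i) • e i + (σ n * c n) • v) δ' := by
  let K : Set (X × X) := (fun t : (ℕ → ℝ) × (ℕ → ℝ) =>
      (∑ i ∈ Finset.range n, t.1 i • e i, ∑ i ∈ Finset.range n, (t.2 i * t.1 i) • e i)) ''
    (Set.univ.pi (fun i => Set.Icc (-‖f i‖) ‖f i‖) ×ˢ Set.univ.pi fun _ => {1, -1})
  have hK : IsCompact K := ((isCompact_univ_pi fun i => isCompact_Icc).prod
    (isCompact_univ_pi fun _ => (Set.toFinite _).isCompact)).image (by fun_prop)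
  have hKM : ∀ p ∈ K, p.1 ∈ M ∧ p.2 ∈ M := by
    rintro _ ⟨t, -, rfl⟩
    exact ⟨M.sum_mem fun i hi => M.smul_mem _ (heM i (Finset.mem_range.1 hi)),
      M.sum_mem fun i hi => M.smul_mem _ (heM i (Finset.mem_range.1 hi))⟩
  have hKacc : ∀ p ∈ K, ¬Accepts ε M p δ := by
    rintro _ ⟨t, ⟨ht1, ht2⟩, rfl⟩
    exact hacc t.1 t.2 (fun i _ => abs_le.2 (ht1 i trivial)) (fun i _ => by simpa using ht2 i trivial)
  obtain ⟨L, hLM, hL, h⟩ :=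
    hM.exists_forall_not_accepts_of_isCompact hε hbig hK hKM hδ hKacc
  obtain ⟨v, hvL, hv0, hfv⟩ := hL.exists_mem_forall_eq_zero f n
  obtain ⟨g, hg⟩ := SeparatingDual.exists_eq_one (R := ℝ) hv0
  refine ⟨v, hLM hvL, g - ∑ i ∈ Finset.range n, g (e i) • f i, ?_, hfv, ?_, ?_⟩
  · have : ∑ i ∈ Finset.range n, g (e i) * f i v = 0 :=
      Finset.sum_eq_zero fun i hi => by rw [hfv i (Finset.mem_range.1 hi), mul_zero]
    simp [hg, this]
  · intro j hj
    have : ∑ i ∈ Finset.range n, g (e i) * f i (e j) = g (e j) := by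
      rw [Finset.sum_eq_single_of_mem j (Finset.mem_range.2 hj), hef j hj j hj, if_pos rfl, mul_one]
      intro i hi hij
      rw [hef i (Finset.mem_range.1 hi) j hj, if_neg hij, mul_zero]
    simp [this]
  · intro c σ hc hσ
    have hmem : (∑ i ∈ Finset.range n, c i • e i, ∑ i ∈ Finset.range n, (σ i * c i) • e i) ∈ K := by
      refine ⟨(fun i => if i < n then c i else 0, fun i => if i < n then σ i else 1),
        ⟨fun i _ => ?_, fun i _ => ?_⟩, ?_⟩
      · dsimp only
        split_ifs with hi
        · exact abs_le.1 (hc i hi)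
        · simp
      · dsimp only
        split_ifs with hi
        · simpa using hσ i (hi.trans n.lt_succ_self)
        · simp
      · refine Prod.ext ?_ ?_ <;> dsimp only <;>
          exact Finset.sum_congr rfl fun i hi => by simp [Finset.mem_range.1 hi]
    have := h (c n • v) (L.smul_mem _ hvL) _ hmem
    rcases hσ n n.lt_succ_self with hs | hs
    · simpa [hs] using this.1
    · simpa [hs] using this.2

lemma AcceptStable.exists_biorthogonal {ε : ℝ} (hε : 0 ≤ ε) {M : Submodule ℝ X}
    (hM : AcceptStable ε M) (hbig : ClosedInfDim M) (h0 : ¬Accepts ε M 0 0) :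
    ∃ (e : ℕ → X) (f : ℕ → X →L[ℝ] ℝ), (∀ i j, f i (e j) = if i = j then 1 else 0) ∧
      ∀ n, ∀ c σ : ℕ → ℝ, (∀ i < n, |c i| ≤ ‖f i‖) → (∀ i < n, σ i = 1 ∨ σ i = -1) →
        ε * ‖∑ i ∈ Finset.range n, c i • e i‖ ≤
          ‖∑ i ∈ Finset.range n, (σ i * c i) • e i‖ + 1 := by
  obtain ⟨a, ha⟩ := exists_seq_of_forall_extend (α := X × (X →L[ℝ] ℝ))
    (fun n a => (∀ i < n, (a i).1 ∈ M) ∧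
      (∀ i < n, ∀ j < n, (a i).2 (a j).1 = if i = j then 1 else 0) ∧
      ∀ c σ : ℕ → ℝ, (∀ i < n, |c i| ≤ ‖(a i).2‖) → (∀ i < n, σ i = 1 ∨ σ i = -1) →
        ¬Accepts ε M (∑ i ∈ Finset.range n, c i • (a i).1,
          ∑ i ∈ Finset.range n, (σ i * c i) • (a i).1) (1 - (1 / 2) ^ n))
    (by
      rintro n a b hab ⟨h1, h2, h3⟩
      refine ⟨fun i hi => hab i hi ▸ h1 i hi,
        fun i hi j hj => by rw [← hab i hi, ← hab j hj]; exact h2 i hi j hj,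
        fun c σ hc hσ => ?_⟩
      have hsum : ∀ c : ℕ → ℝ, ∑ i ∈ Finset.range n, c i • (b i).1 =
          ∑ i ∈ Finset.range n, c i • (a i).1 := fun c =>
        Finset.sum_congr rfl fun i hi => by rw [hab i (Finset.mem_range.1 hi)]
      rw [hsum, hsum fun i => σ i * c i]
      exact h3 c σ (fun i hi => by rw [hab i hi]; exact hc i hi) hσ)
    (by
      intro a
      refine ⟨by simp, by simp, fun c σ _ _ => ?_⟩
      simpa [← Prod.zero_eq_mk] using h0)
    (by
      rintro n a ⟨h1, h2, h3⟩
      obtain ⟨v, hvM, g, hgv, hfv, hge, h⟩ := hM.exists_extend hε hbig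
        (show (1 - (1 / 2) ^ n : ℝ) < 1 - (1 / 2) ^ (n + 1) by
          have : (0 : ℝ) < (1 / 2) ^ n := by positivity
          rw [pow_succ]; linarith) n (fun i => (a i).1) (fun i => (a i).2) h1 h2 h3
      have hlt : ∀ i < n, Function.update a n (v, g) i = a i :=
        fun i hi => Function.update_of_ne hi.ne _ _
      have hn : Function.update a n (v, g) n = (v, g) := Function.update_self _ _ _
      refine ⟨(v, g), fun i hi => ?_, fun i hi j hj => ?_, fun c σ hc hσ => ?_⟩
      · rcases Nat.lt_succ_iff_lt_or_eq.1 hi with hi | rfl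
        · rw [hlt i hi]; exact h1 i hi
        · rw [hn]; exact hvM
      · rcases Nat.lt_succ_iff_lt_or_eq.1 hi with hi | rfl <;>
          rcases Nat.lt_succ_iff_lt_or_eq.1 hj with hj | rfl
        · rw [hlt i hi, hlt j hj]; exact h2 i hi j hj
        · rw [hlt i hi, hn, if_neg hi.ne]; exact hfv i hi
        · rw [hlt j hj, hn, if_neg hj.ne']; exact hge j hj
        · rw [hn, if_pos rfl]; exact hgv
      · have hsum : ∀ c : ℕ → ℝ,
            ∑ i ∈ Finset.range (n + 1), c i • (Function.update a n (v, g) i).1 =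
              ∑ i ∈ Finset.range n, c i • (a i).1 + c n • v := fun c => by
          rw [Finset.sum_range_succ, hn]
          congr 1
          exact Finset.sum_congr rfl fun i hi => by rw [hlt i (Finset.mem_range.1 hi)]
        rw [hsum, hsum fun i => σ i * c i]
        exact h c σ (fun i hi => by rw [← hlt i hi]; exact hc i (hi.trans n.lt_succ_self)) hσ)
  refine ⟨fun i => (a i).1, fun i => (a i).2, fun i j => ?_, fun n c σ hc hσ => ?_⟩
  · exact (ha (max i j + 1)).2.1 i (by omega) j (by omega)
  · have h := (ha n).2.2 c σ hc hσ
    unfold Accepts at h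
    push Not at h
    obtain ⟨Y, Z, -, -, -, -, hYZ⟩ := h
    have h := hYZ 0 Y.zero_mem 0 Z.zero_mem
    have : (0 : ℝ) < (1 / 2) ^ n := by positivity
    simp only [add_zero, sub_zero] at h
    linarith

/-- The sequences `e` and `f` are biorthogonal and finite sums along `e` satisfy the
unconditionality inequality with constant `C`. -/
structure IsUnconditionalSystem (C : ℝ) (e : ℕ → X) (f : ℕ → X →L[ℝ] ℝ) : Prop where
  biorthogonal : ∀ i j, f i (e j) = if i = j then 1 else 0
  norm_le : ∀ n, ∀ c σ : ℕ → ℝ, (∀ i, σ i = 1 ∨ σ i = -1) →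
    ‖∑ i ∈ Finset.range n, (σ i * c i) • e i‖ ≤ C * ‖∑ i ∈ Finset.range n, c i • e i‖

lemma apply_sum_of_biorthogonal {e : ℕ → X} {f : ℕ → X →L[ℝ] ℝ}
    (h : ∀ i j, f i (e j) = if i = j then 1 else 0) (c : ℕ → ℝ) (n i : ℕ) :
    f i (∑ j ∈ Finset.range n, c j • e j) = if i < n then c i else 0 := by
  simp [h]

lemma AcceptStable.exists_isUnconditionalSystem {ε : ℝ} (hε : 0 < ε) {M : Submodule ℝ X}
    (hM : AcceptStable ε M) (hbig : ClosedInfDim M) (h0 : ¬Accepts ε M 0 0) :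
    ∃ (e : ℕ → X) (f : ℕ → X →L[ℝ] ℝ), IsUnconditionalSystem (2 / ε) e f := by
  obtain ⟨e, f, hef, h⟩ := hM.exists_biorthogonal hε.le hbig h0
  refine ⟨e, f, hef, fun n c σ hσ => ?_⟩
  have hσσ : ∀ i, σ i * (σ i * c i) = c i := fun i => by
    rcases hσ i with hs | hs <;> simp [hs]
  set d := ∑ i ∈ Finset.range n, c i • e i with hd
  have hfd : ∀ i < n, f i d = c i := fun i hi => by
    rw [hd, apply_sum_of_biorthogonal hef, if_pos hi]
  rcases eq_or_ne d 0 with hd0 | hd0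
  · have hc : ∀ i < n, c i = 0 := fun i hi => by rw [← hfd i hi, hd0, map_zero]
    rw [Finset.sum_eq_zero fun i hi => by rw [hc i (Finset.mem_range.1 hi), mul_zero, zero_smul],
      hd0]
    simp
  · have hdpos : 0 < ‖d‖ := norm_pos_iff.2 hd0
    have hscale : ∀ b : ℕ → ℝ, ‖∑ i ∈ Finset.range n, (‖d‖⁻¹ * b i) • e i‖ =
        ‖d‖⁻¹ * ‖∑ i ∈ Finset.range n, b i • e i‖ := fun b => by
      simp only [mul_smul, ← Finset.smul_sum, norm_smul, norm_inv, norm_norm]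
    have hbound := h n (fun i => ‖d‖⁻¹ * (σ i * c i)) σ (fun i hi => ?_) (fun i _ => hσ i)
    · simp only [mul_left_comm (σ _) ‖d‖⁻¹, hσσ] at hbound
      rw [hscale, hscale, ← hd, inv_mul_cancel₀ hdpos.ne'] at hbound
      field_simp at hbound ⊢
      linarith
    · have : |σ i| = 1 := by rcases hσ i with hs | hs <;> simp [hs]
      rw [abs_mul, abs_mul, this, one_mul, abs_inv, abs_norm, ← hfd i hi, inv_mul_le_iff₀ hdpos,
        mul_comm]
      exact (f i).le_opNorm d

end Construction

section Basis

variable {E : Type*} [NormedAddCommGroup E] [NormedSpace ℝ E]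

/-- The `N`-th partial sum operator of a sequence `e` with coefficient functionals `f`. -/
def partialSumCLM (e : ℕ → E) (f : ℕ → E →L[ℝ] ℝ) (N : ℕ) : E →L[ℝ] E :=
  ∑ i ∈ Finset.range N, (f i).smulRight (e i)

lemma partialSumCLM_apply (e : ℕ → E) (f : ℕ → E →L[ℝ] ℝ) (N : ℕ) (x : E) :
    partialSumCLM e f N x = ∑ i ∈ Finset.range N, f i x • e i := by
  simp [partialSumCLM]

namespace IsUnconditionalSystem

variable {C : ℝ} {e : ℕ → E} {f : ℕ → E →L[ℝ] ℝ}

lemma partialSumCLM_eventually_eq (h : IsUnconditionalSystem C e f) {x : E}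
    (hx : x ∈ Submodule.span ℝ (Set.range e)) : ∀ᶠ N in atTop, partialSumCLM e f N x = x := by
  induction hx using Submodule.span_induction with
  | mem x hx =>
    obtain ⟨j, rfl⟩ := hx
    filter_upwards [eventually_gt_atTop j] with N hN
    simp [partialSumCLM_apply, h.biorthogonal, hN]
  | zero => simp
  | add x y _ _ hx hy =>
    filter_upwards [hx, hy] with N hx hy
    rw [map_add, hx, hy]
  | smul a x _ hx =>
    filter_upwards [hx] with N hx
    rw [map_smul, hx]

lemma norm_partialSumCLM_le (h : IsUnconditionalSystem C e f)
    (hd : Dense (Submodule.span ℝ (Set.range e) : Set E)) (N : ℕ) (x : E) :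
    ‖partialSumCLM e f N x‖ ≤ (1 + C) / 2 * ‖x‖ := by
  refine hd.induction (P := fun x => ‖partialSumCLM e f N x‖ ≤ (1 + C) / 2 * ‖x‖) ?_
    (isClosed_le (by fun_prop) (by fun_prop)) x
  intro x hx
  obtain ⟨m, hm, hNm⟩ :=
    ((h.partialSumCLM_eventually_eq hx).and (eventually_ge_atTop N)).exists
  have hle := h.norm_le m (fun i => f i x) (fun i => if i < N then 1 else -1)
    (fun i => by split_ifs <;> simp)
  rw [← partialSumCLM_apply, hm] at hle
  have hsplit : ∑ i ∈ Finset.range m, ((if i < N then (1 : ℝ) else -1) * f i x) • e i =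
      (2 : ℝ) • partialSumCLM e f N x - x := by
    have hadd : ∑ i ∈ Finset.range m, ((if i < N then (1 : ℝ) else -1) * f i x) • e i +
        ∑ i ∈ Finset.range m, f i x • e i = (2 : ℝ) • partialSumCLM e f N x := by
      rw [partialSumCLM_apply, ← Finset.sum_add_distrib, Finset.smul_sum]
      symm
      refine Finset.sum_congr_of_eq_on_inter (fun i hi hi' => ?_) (fun i _ hi => ?_) fun i hi _ => ?_
      · exact absurd (Finset.range_mono hNm hi) hi'
      · rw [if_neg (by simpa using hi)]
        simp
      · rw [if_pos (Finset.mem_range.1 hi), one_mul, two_smul]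
    rw [eq_sub_iff_add_eq, ← hadd, ← partialSumCLM_apply e f m, hm]
  have h2 : (2 : ℝ) • partialSumCLM e f N x = ((2 : ℝ) • partialSumCLM e f N x - x) + x := by abel
  have h3 : 2 * ‖partialSumCLM e f N x‖ ≤ C * ‖x‖ + ‖x‖ := by
    calc 2 * ‖partialSumCLM e f N x‖ = ‖(2 : ℝ) • partialSumCLM e f N x‖ := by simp [norm_smul]
      _ ≤ ‖(2 : ℝ) • partialSumCLM e f N x - x‖ + ‖x‖ := by
        conv_lhs => rw [h2]
        exact norm_add_le _ _
      _ ≤ _ := by rw [← hsplit]; gcongr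
  linarith

lemma tendsto_partialSumCLM (h : IsUnconditionalSystem C e f)
    (hd : Dense (Submodule.span ℝ (Set.range e) : Set E)) (x : E) :
    Tendsto (fun N => partialSumCLM e f N x) atTop (𝓝 x) := by
  set K := max ((1 + C) / 2) 0
  have hK0 : 0 ≤ K := le_max_right _ _
  rw [Metric.tendsto_atTop']
  intro η hη
  obtain ⟨z, hz, hxz⟩ := Metric.dense_iff.1 hd x (η / (K + 1)) (by positivity)
  obtain ⟨n, hn⟩ := eventually_atTop.1 (h.partialSumCLM_eventually_eq hxz)
  refine ⟨n, fun N hN => ?_⟩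
  have hz' : ‖x - z‖ < η / (K + 1) := by rwa [← dist_eq_norm, dist_comm]
  have hb : ‖partialSumCLM e f N (x - z)‖ ≤ K * ‖x - z‖ :=
    (h.norm_partialSumCLM_le hd N _).trans (by gcongr; exact le_max_left _ _)
  calc dist (partialSumCLM e f N x) x = ‖partialSumCLM e f N (x - z) - (x - z)‖ := by
        rw [dist_eq_norm, map_sub, hn N hN.le]; congr 1; abel
    _ ≤ K * ‖x - z‖ + ‖x - z‖ := (norm_sub_le _ _).trans (by gcongr)
    _ = (K + 1) * ‖x - z‖ := by ring
    _ < (K + 1) * (η / (K + 1)) := by gcongr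
    _ = η := by field_simp

lemma isSchauderBasis (h : IsUnconditionalSystem C e f)
    (hd : Dense (Submodule.span ℝ (Set.range e) : Set E)) : IsSchauderBasis e := by
  intro x
  refine ⟨fun i => f i x, ?_, fun c hc => ?_⟩
  · simpa only [partialSumCLM_apply] using h.tendsto_partialSumCLM hd x
  · ext i
    have h1 := ((f i).continuous.tendsto x).comp hc
    refine tendsto_nhds_unique (tendsto_const_nhds.congr' ?_) h1
    filter_upwards [eventually_gt_atTop i] with N hN
    rw [Function.comp, apply_sum_of_biorthogonal h.biorthogonal, if_pos hN]

lemma norm_sum_Ico_le (h : IsUnconditionalSystem C e f) (c σ : ℕ → ℝ)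
    (hσ : ∀ i, σ i = 1 ∨ σ i = -1) {m n : ℕ} (hmn : m ≤ n) :
    ‖∑ i ∈ Finset.Ico m n, (σ i * c i) • e i‖ ≤ C * ‖∑ i ∈ Finset.Ico m n, c i • e i‖ := by
  have hsum : ∀ b : ℕ → ℝ, ∑ i ∈ Finset.Ico m n, b i • e i =
      ∑ i ∈ Finset.range n, (if i < m then 0 else b i) • e i := by
    intro b
    have h0 : ∑ i ∈ Finset.range m, (if i < m then 0 else b i) • e i = 0 :=
      Finset.sum_eq_zero fun i hi => by rw [if_pos (Finset.mem_range.1 hi), zero_smul]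
    rw [← Finset.sum_range_add_sum_Ico _ hmn, h0, zero_add]
    exact Finset.sum_congr rfl fun i hi => by rw [if_neg (Finset.mem_Ico.1 hi).1.not_gt]
  rw [hsum, hsum]
  convert h.norm_le n (fun i => if i < m then 0 else c i) σ hσ using 5
  simp

lemma isUnconditionalSchauderBasis [CompleteSpace E] (h : IsUnconditionalSystem C e f)
    (hd : Dense (Submodule.span ℝ (Set.range e) : Set E)) :
    IsUnconditionalSchauderBasis (max C 1) e := by
  refine ⟨h.isSchauderBasis hd, le_max_right _ _, fun c x hc σ hσ => ?_⟩
  have hcauchy : CauchySeq fun N => ∑ i ∈ Finset.range N, (σ i * c i) • e i := by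
    rw [Metric.cauchySeq_iff']
    intro η hη
    obtain ⟨N, hN⟩ := Metric.cauchySeq_iff'.1 hc.cauchySeq (η / max C 1) (by positivity)
    refine ⟨N, fun n hn => ?_⟩
    have h1 := hN n hn
    rw [dist_eq_norm, ← Finset.sum_Ico_eq_sub _ hn] at h1 ⊢
    calc _ ≤ C * ‖∑ i ∈ Finset.Ico N n, c i • e i‖ := h.norm_sum_Ico_le c σ hσ hn
      _ ≤ max C 1 * ‖∑ i ∈ Finset.Ico N n, c i • e i‖ := by gcongr; exact le_max_left _ _
      _ < max C 1 * (η / max C 1) := by gcongr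
      _ = η := by field_simp
  obtain ⟨y, hy⟩ := cauchySeq_tendsto_of_complete hcauchy
  refine ⟨y, hy, le_of_tendsto_of_tendsto' hy.norm (hc.norm.const_mul _) fun n => ?_⟩
  exact (h.norm_le n c σ hσ).trans (by gcongr; exact le_max_left _ _)

lemma exists_closed_subspace [CompleteSpace E] (h : IsUnconditionalSystem C e f) :
    ∃ Y : Submodule ℝ E, IsClosed (Y : Set E) ∧ ¬FiniteDimensional ℝ Y ∧
      ∃ (C' : ℝ) (e' : ℕ → Y), IsUnconditionalSchauderBasis C' e' := by
  let Y := (Submodule.span ℝ (Set.range e)).topologicalClosure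
  have hY : IsClosed (Y : Set E) := Submodule.isClosed_topologicalClosure _
  have heY : ∀ i, e i ∈ Y := fun i =>
    Submodule.le_topologicalClosure _ (Submodule.subset_span ⟨i, rfl⟩)
  have := hY.completeSpace_coe
  let e' : ℕ → Y := fun i => ⟨e i, heY i⟩
  have hsys : IsUnconditionalSystem C e' fun i => (f i).comp Y.subtypeL := by
    refine ⟨fun i j => h.biorthogonal i j, fun n c σ hσ => ?_⟩
    simpa [Submodule.coe_norm, e'] using h.norm_le n c σ hσ
  have hdense : Dense (Submodule.span ℝ (Set.range e') : Set Y) := by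
    intro x
    have himg : ((↑) : Y → E) '' (Submodule.span ℝ (Set.range e') : Set Y) =
        Submodule.span ℝ (Set.range e) := by
      have : (Submodule.span ℝ (Set.range e')).map Y.subtype = Submodule.span ℝ (Set.range e) := by
        rw [Submodule.map_span, ← Set.range_comp]
        rfl
      rw [← this]
      rfl
    rw [closure_subtype, himg]
    exact x.2
  have hli : LinearIndependent ℝ e' := by
    rw [linearIndependent_iff']
    intro s g hg i hi
    have := congrArg (fun x : Y => f i x) hg
    simpa [e', h.biorthogonal, hi] using this
  refine ⟨Y, hY, fun hfin => ?_, max C 1, e', hsys.isUnconditionalSchauderBasis hdense⟩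
  exact Infinite.not_finite (hli.finite)

end IsUnconditionalSystem

end Basis

section Decomposition

variable {E : Type*} [NormedAddCommGroup E] [NormedSpace ℝ E]

lemma IsSchauderBasis.eq_of_tendsto {e : ℕ → E} (h : IsSchauderBasis e) {x : E} {c c' : ℕ → ℝ}
    (hc : Tendsto (fun N => ∑ n ∈ Finset.range N, c n • e n) atTop (𝓝 x))
    (hc' : Tendsto (fun N => ∑ n ∈ Finset.range N, c' n • e n) atTop (𝓝 x)) : c = c' :=
  (h x).unique hc hc'

lemma tendsto_sum_range_single (e : ℕ → E) (k : ℕ) (a : ℝ) :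
    Tendsto (fun N => ∑ n ∈ Finset.range N, (Pi.single k a : ℕ → ℝ) n • e n) atTop
      (𝓝 (a • e k)) := by
  refine tendsto_const_nhds.congr' ?_
  filter_upwards [eventually_gt_atTop k] with N hN
  rw [Finset.sum_eq_single_of_mem k (Finset.mem_range.2 hN)]
  · simp
  · intro i _ hi
    rw [Pi.single_eq_of_ne hi, zero_smul]

lemma IsSchauderBasis.linearIndependent {e : ℕ → E} (h : IsSchauderBasis e) :
    LinearIndependent ℝ e := by
  rw [linearIndependent_iff']
  intro s g hg i hi
  have h0 : Tendsto (fun N => ∑ n ∈ Finset.range N, (0 : ℕ → ℝ) n • e n) atTop (𝓝 0) := by simp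
  have h1 : Tendsto (fun N => ∑ n ∈ Finset.range N, (if n ∈ s then g n else 0) • e n) atTop
      (𝓝 0) := by
    refine tendsto_const_nhds.congr' ?_
    filter_upwards [eventually_gt_atTop (s.sup id)] with N hN
    rw [← hg]
    refine Finset.sum_congr_of_eq_on_inter (fun n hn hn' => ?_) (fun n _ hn => ?_) fun n hn _ => ?_
    · exact absurd (Finset.mem_range.2 ((Finset.le_sup (f := id) hn).trans_lt hN)) hn'
    · simp [hn]
    · simp [hn]
  have := congrFun (h.eq_of_tendsto h1 h0) i
  simpa [hi] using this

lemma IsUnconditionalSchauderBasis.exists_sign_operator {C : ℝ} {e : ℕ → E}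
    (h : IsUnconditionalSchauderBasis C e) (σ : ℕ → ℝ) (hσ : ∀ n, σ n = 1 ∨ σ n = -1) :
    ∃ T : E →L[ℝ] E, (∀ x, T (T x) = x) ∧ ∀ n, T (e n) = σ n • e n := by
  obtain ⟨hb, -, hu⟩ := h
  choose c hc hcuniq using hb
  choose y hy hyC using fun x => hu (c x) x (hc x) σ hσ
  have hcy : ∀ x z : E, ∀ a : ℕ → ℝ,
      Tendsto (fun N => ∑ n ∈ Finset.range N, a n • e n) atTop (𝓝 x) →
      Tendsto (fun N => ∑ n ∈ Finset.range N, (σ n * a n) • e n) atTop (𝓝 z) → y x = z := by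
    intro x z a ha hz
    obtain rfl : a = c x := hcuniq x a ha
    exact tendsto_nhds_unique (hy x) hz
  let T₀ : E →ₗ[ℝ] E :=
    { toFun := y
      map_add' := fun x x' => hcy _ _ (c x + c x')
        (by simpa [add_smul, Finset.sum_add_distrib] using (hc x).add (hc x'))
        (by simpa [mul_add, add_smul, Finset.sum_add_distrib] using (hy x).add (hy x'))
      map_smul' := fun a x => hcy _ _ (a • c x)
        (by simpa [mul_smul, Finset.smul_sum] using (hc x).const_smul a)
        (by simpa [mul_smul, mul_left_comm (σ _) a, Finset.smul_sum] using (hy x).const_smul a) }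
  refine ⟨T₀.mkContinuous C hyC, fun x => ?_, fun n => ?_⟩
  · refine hcy _ _ _ (hy x) ((hc x).congr fun N => Finset.sum_congr rfl fun n _ => ?_)
    rcases hσ n with hs | hs <;> simp [hs]
  · refine hcy _ _ (Pi.single n 1) (by simpa using tendsto_sum_range_single e n 1) ?_
    refine (tendsto_sum_range_single e n (σ n)).congr fun N => Finset.sum_congr rfl fun i _ => ?_
    rcases eq_or_ne i n with rfl | hi
    · simp
    · simp [hi]

lemma IsUnconditionalSchauderBasis.decomposable {C : ℝ} {e : ℕ → E}
    (h : IsUnconditionalSchauderBasis C e) : Decomposable E := by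
  obtain ⟨T, hTT, hTe⟩ := h.exists_sign_operator (fun n => (-1) ^ n) (fun n => neg_one_pow_eq_or ℝ n)
  let U : Submodule ℝ E := LinearMap.ker ((T - ContinuousLinearMap.id ℝ E : E →L[ℝ] E) : E →ₗ[ℝ] E)
  let V : Submodule ℝ E := LinearMap.ker ((T + ContinuousLinearMap.id ℝ E : E →L[ℝ] E) : E →ₗ[ℝ] E)
  have hU : ∀ x, x ∈ U ↔ T x = x := fun x => by simp [U, sub_eq_zero]
  have hV : ∀ x, x ∈ V ↔ T x = -x := fun x => by simp [V, add_eq_zero_iff_eq_neg]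
  have hinf : ∀ (W : Submodule ℝ E) (φ : ℕ → ℕ), Function.Injective φ → (∀ n, e (φ n) ∈ W) →
      ¬FiniteDimensional ℝ W := by
    intro W φ hφ hW hfin
    have hli : LinearIndependent ℝ fun n => (⟨e (φ n), hW n⟩ : W) :=
      LinearIndependent.of_comp W.subtype (h.1.linearIndependent.comp φ hφ)
    exact Infinite.not_finite hli.finite
  have hbound : ∀ u ∈ U, ∀ v ∈ V, ‖u‖ ≤ (1 + ‖T‖) / 2 * ‖u + v‖ := by
    intro u hu v hv
    have h2 : (2 : ℝ) • u = (u + v) + T (u + v) := by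
      rw [map_add, (hU u).1 hu, (hV v).1 hv, two_smul]; abel
    have h3 : 2 * ‖u‖ ≤ ‖u + v‖ + ‖T‖ * ‖u + v‖ := by
      calc 2 * ‖u‖ = ‖(2 : ℝ) • u‖ := by simp [norm_smul]
        _ ≤ ‖u + v‖ + ‖T (u + v)‖ := by rw [h2]; exact norm_add_le _ _
        _ ≤ _ := by gcongr; exact T.le_opNorm _
    linarith
  have htop : U ⊔ V = ⊤ := by
    refine eq_top_iff.2 fun x _ => Submodule.mem_sup.2
      ⟨(1 / 2 : ℝ) • (x + T x), ?_, (1 / 2 : ℝ) • (x - T x), ?_, ?_⟩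
    · rw [hU, map_smul, map_add, hTT, add_comm]
    · rw [hV, map_smul, map_sub, hTT, ← smul_neg, neg_sub]
    · rw [← smul_add, add_add_sub_cancel, ← two_smul ℝ x, smul_smul]; norm_num
  refine ⟨U, V, ContinuousLinearMap.isClosed_ker _, ContinuousLinearMap.isClosed_ker _,
    hinf U (fun n => 2 * n) (fun a b hab => by simpa using hab) fun n => ?_,
    hinf V (fun n => 2 * n + 1) (fun a b hab => by simpa using hab) fun n => ?_,
    htop, ?_, by simp [htop], _, hbound⟩
  · rw [hU, hTe]; simp
  · rw [hV, hTe]; simp [pow_succ]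
  · refine (Submodule.eq_bot_iff _).2 fun x hx => ?_
    have := hbound x hx.1 (-x) (V.neg_mem hx.2)
    simpa using this

lemma Decomposable.not_isHI (h : Decomposable E) : ¬IsHI E := by
  rintro ⟨-, hHI⟩
  obtain ⟨U, V, hU, hV, hUfin, hVfin, htop, hbot, -, C, hC⟩ := h
  let ι : (⊤ : Submodule ℝ E) →ₗ[ℝ] E := (⊤ : Submodule ℝ E).subtype
  have hfin : ∀ W : Submodule ℝ E, ¬FiniteDimensional ℝ W →
      ¬FiniteDimensional ℝ (W.comap ι) := by
    intro W hW hfin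
    refine hW ?_
    have : W = (W.comap ι).map ι := by
      rw [Submodule.map_comap_eq, Submodule.range_subtype, top_inf_eq]
    rw [this]
    infer_instance
  have hsup : U.comap ι ⊔ V.comap ι = ⊤ := by
    refine eq_top_iff.2 fun x _ => ?_
    obtain ⟨u, hu, v, hv, huv⟩ := Submodule.mem_sup.1
      (show (x : E) ∈ U ⊔ V by rw [htop]; trivial)
    exact Submodule.mem_sup.2 ⟨⟨u, trivial⟩, hu, ⟨v, trivial⟩, hv, Subtype.ext huv⟩
  refine hHI ⊤ isClosed_univ ⟨U.comap ι, V.comap ι, hU.preimage continuous_subtype_val,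
    hV.preimage continuous_subtype_val, hfin U hUfin, hfin V hVfin, hsup, ?_, ?_, C,
    fun u hu v hv => hC u hu v hv⟩
  · rw [← Submodule.comap_inf, hbot, Submodule.comap_bot]
    exact Submodule.ker_subtype _
  · rw [hsup]; exact isClosed_univ

end Decomposition

section Dichotomy

variable {X : Type*} [NormedAddCommGroup X] [NormedSpace ℝ X]

/-- Any two closed infinite-dimensional subspaces of `M` are, up to `ε`, at zero angle. -/
def HasSmallAngles (ε : ℝ) (M : Submodule ℝ X) : Prop :=
  ∀ Y Z, ClosedInfDim Y → ClosedInfDim Z → Y ≤ M → Z ≤ M →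
    ∃ y ∈ Y, ∃ z ∈ Z, ‖y - z‖ < ε * ‖y + z‖

lemma exists_isUnconditionalSystem_or_hasSmallAngles {ε : ℝ} (hε : 0 < ε) {M : Submodule ℝ X}
    (hM : ClosedInfDim M) (hsep : TopologicalSpace.IsSeparable (M : Set X)) :
    (∃ (C : ℝ) (e : ℕ → X) (f : ℕ → X →L[ℝ] ℝ), IsUnconditionalSystem C e f) ∨
      ∃ N ≤ M, ClosedInfDim N ∧ HasSmallAngles ε N := by
  obtain ⟨N, hNM, hN, hst⟩ := exists_acceptStable hε.le hM hsep
  by_cases h0 : Accepts ε N 0 0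
  · right
    refine ⟨N, hNM, hN, fun Y Z hY hZ hYN hZN => ?_⟩
    obtain ⟨y, hy, z, hz, h⟩ := h0 Y Z hY hZ hYN hZN
    exact ⟨y, hy, z, hz, by simpa using h⟩
  · exact Or.inl ⟨_, hst.exists_isUnconditionalSystem hε hN h0⟩

lemma isHI_of_hasSmallAngles {N : Submodule ℝ X} (hN : ClosedInfDim N)
    (h : ∀ ε > 0, HasSmallAngles ε N) : IsHI N := by
  refine ⟨fun hfin => hN.2 ((Submodule.fg_iff_finiteDimensional _).2 hfin), ?_⟩
  rintro Y hY ⟨U, V, hU, hV, hUfin, hVfin, -, -, -, C, hC⟩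
  let ι : Y →ₗ[ℝ] X := N.subtype ∘ₗ Y.subtype
  have hι : Topology.IsClosedEmbedding ι :=
    hN.1.isClosedEmbedding_subtypeVal.comp hY.isClosedEmbedding_subtypeVal
  have hbig : ∀ W : Submodule ℝ Y, IsClosed (W : Set Y) → ¬FiniteDimensional ℝ W →
      ClosedInfDim (W.map ι) := by
    intro W hW hWfin
    refine ⟨hι.isClosedMap _ hW, fun hfg => hWfin ?_⟩
    exact (Submodule.fg_iff_finiteDimensional _).1
      (Submodule.fg_of_fg_map_injective ι hι.injective hfg)
  have hle : ∀ W : Submodule ℝ Y, W.map ι ≤ N := by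
    rintro W _ ⟨w, -, rfl⟩
    exact (w : N).2
  set K := 2 * |C| + 1 with hK
  have hKpos : 0 < K := by positivity
  obtain ⟨_, ⟨u, hu, rfl⟩, _, ⟨v, hv, rfl⟩, huv⟩ := h K⁻¹ (inv_pos.2 hKpos) _ _
    (hbig U hU hUfin) (hbig V hV hVfin) (hle U) (hle V)
  rw [← map_sub, ← map_add] at huv
  replace huv : ‖u - v‖ < K⁻¹ * ‖u + v‖ := huv
  rw [lt_inv_mul_iff₀ hKpos] at huv
  have h1 : ‖u‖ ≤ |C| * ‖u - v‖ := by
    have := hC u hu (-v) (V.neg_mem hv)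
    rw [← sub_eq_add_neg] at this
    exact this.trans (by gcongr; exact le_abs_self C)
  have h2 : ‖u + v‖ ≤ 2 * ‖u‖ + ‖u - v‖ := by
    calc ‖u + v‖ = ‖(2 : ℝ) • u - (u - v)‖ := by congr 1; rw [two_smul]; abel
      _ ≤ ‖(2 : ℝ) • u‖ + ‖u - v‖ := norm_sub_le _ _
      _ = _ := by simp [norm_smul]
  rw [hK] at huv
  linarith

lemma exists_isUnconditionalSystem_or_isHI (hX : ¬FiniteDimensional ℝ X) :
    (∃ (C : ℝ) (e : ℕ → X) (f : ℕ → X →L[ℝ] ℝ), IsUnconditionalSystem C e f) ∨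
      ∃ N : Submodule ℝ X, ClosedInfDim N ∧ IsHI N := by
  have htop : ClosedInfDim (⊤ : Submodule ℝ X) :=
    ⟨isClosed_univ, fun hfg => hX (Module.finite_def.2 hfg)⟩
  obtain ⟨M, -, hM, hsep, -⟩ := exists_diagonal_subspace (fun _ => (⊤ : Submodule ℝ X))
    antitone_const fun _ => htop
  refine or_iff_not_imp_left.2 fun hno => ?_
  have step : ∀ (L : {L : Submodule ℝ X // L ≤ M ∧ ClosedInfDim L}) (n : ℕ),
      ∃ L' : {L : Submodule ℝ X // L ≤ M ∧ ClosedInfDim L}, L'.1 ≤ L.1 ∧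
        HasSmallAngles (1 / ((n : ℝ) + 1)) L'.1 := by
    rintro ⟨L, hLM, hL⟩ n
    obtain ⟨N, hNL, hN, h⟩ := (exists_isUnconditionalSystem_or_hasSmallAngles
      (ε := 1 / ((n : ℝ) + 1)) (by positivity) hL (hsep.mono hLM)).resolve_left hno
    exact ⟨⟨N, hNL.trans hLM, hN⟩, hNL, h⟩
  choose g hgle hg using step
  let S : ℕ → {L : Submodule ℝ X // L ≤ M ∧ ClosedInfDim L} :=
    fun n => Nat.rec ⟨M, le_rfl, hM⟩ (fun n L => g L n) n
  obtain ⟨N, -, hN, -, hdiag⟩ := exists_diagonal_subspace (fun n => (S n).1)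
    (antitone_nat_of_succ_le fun n => hgle _ _) (fun n => (S n).2.2)
  refine ⟨N, hN, isHI_of_hasSmallAngles hN fun ε hε Y Z hY hZ hYN hZN => ?_⟩
  obtain ⟨n, hn⟩ := exists_nat_one_div_lt hε
  obtain ⟨y, hy, z, hz, hyz⟩ := hg (S n) n _ _ (hdiag Y hYN hY (n + 1)) (hdiag Z hZN hZ (n + 1))
    inf_le_right inf_le_right
  exact ⟨y, hy.1, z, hz.1, hyz.trans_le (by gcongr)⟩

end Dichotomy

/-- **Gowers' dichotomy theorem.** Every infinite-dimensional Banach space contains an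
infinite-dimensional closed subspace `Y` which either has an unconditional Schauder basis
or is hereditarily indecomposable; and these two alternatives are mutually exclusive. -/
theorem gowers_dichotomy (X : Type*) [NormedAddCommGroup X] [NormedSpace ℝ X]
    [CompleteSpace X] (hX : ¬FiniteDimensional ℝ X) :
    ∃ Y : Submodule ℝ X, IsClosed (Y : Set X) ∧ ¬FiniteDimensional ℝ Y ∧
      ((∃ (C : ℝ) (e : ℕ → Y), IsUnconditionalSchauderBasis C e) ∨ IsHI ↥Y) ∧
      ¬((∃ (C : ℝ) (e : ℕ → Y), IsUnconditionalSchauderBasis C e) ∧ IsHI ↥Y) := by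
  suffices h : ∃ Y : Submodule ℝ X, IsClosed (Y : Set X) ∧ ¬FiniteDimensional ℝ Y ∧
      ((∃ (C : ℝ) (e : ℕ → Y), IsUnconditionalSchauderBasis C e) ∨ IsHI ↥Y) by
    obtain ⟨Y, hY, hfin, h⟩ := h
    refine ⟨Y, hY, hfin, h, ?_⟩
    rintro ⟨⟨C, e, he⟩, hHI⟩
    exact he.decomposable.not_isHI hHI
  rcases exists_isUnconditionalSystem_or_isHI hX with ⟨C, e, f, h⟩ | ⟨N, hN, hHI⟩
  · obtain ⟨Y, hY, hfin, hbasis⟩ := h.exists_closed_subspace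
    exact ⟨Y, hY, hfin, Or.inl hbasis⟩
  · exact ⟨N, hN.1, hHI.1, Or.inr hHI⟩

end
end

section
/- If X is an infinite-dimensional hereditarily indecomposable Banach space, then X is isomorphic to no proper quotient of subspace of itself: for closed subspaces Z ⊆ Y ⊆ X with (Y, Z) ≠ (X, {0}), there is no bounded linear bijection from X onto the quotient Banach space Y/Z. -/
open Filter Topology

noncomputable section

section Perturbation

variable {E F : Type*} [NormedAddCommGroup E] [NormedSpace ℝ E]
  [NormedAddCommGroup F] [NormedSpace ℝ F]

/-- Operators close to a surjective operator are surjective, with uniformly bounded preimages. -/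
lemma exists_preimage_bound_of_near_surjective [CompleteSpace E] [CompleteSpace F] (S : E →L[ℝ] F)
    (hS : Function.Surjective S) :
    ∃ C > 0, ∃ δ > 0, ∀ S' : E →L[ℝ] F, ‖S' - S‖ ≤ δ →
      ∀ x, ∃ y, S' y = x ∧ ‖y‖ ≤ C * ‖x‖ := by
  have hr : S.range = ⊤ := LinearMap.range_eq_top.2 hS
  set g := S.nonlinearRightInverseOfSurjective hr
  have hN : 0 < (g.nnnorm : ℝ) := S.nonlinearRightInverseOfSurjective_nnnorm_pos hr
  refine ⟨2 * g.nnnorm, by positivity, (g.nnnorm : ℝ)⁻¹ / 2, by positivity, fun S' hS' x => ?_⟩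
  have happ : ApproximatesLinearOn S' S Set.univ (g.nnnorm⁻¹ / 2) := by
    intro a _ b _
    rw [← map_sub, ← sub_apply]
    refine ((S' - S).le_opNorm _).trans ?_
    push_cast
    gcongr
  have := happ.surjOn_closedBall_of_nonlinearRightInverse g (ε := 2 * g.nnnorm * ‖x‖) (b := 0)
    (by positivity) (Set.subset_univ _)
  obtain ⟨y, hy, hyx⟩ := this (a := x) (by
    simp only [map_zero, mem_closedBall_zero_iff]
    push_cast
    apply le_of_eq
    field_simp
    ring)
  exact ⟨y, hyx, by simpa using hy⟩

/-- Operators close to a bounded below operator are uniformly bounded below. -/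
lemma bound_below_of_near {A A' : E →L[ℝ] F} {c : ℝ} {y : E} (h : c * ‖y‖ ≤ ‖A y‖)
    (hA : ‖A' - A‖ ≤ c / 2) : c / 2 * ‖y‖ ≤ ‖A' y‖ := by
  have h1 : ‖(A' - A) y‖ ≤ c / 2 * ‖y‖ := ((A' - A).le_opNorm y).trans (by gcongr)
  have h2 : ‖A y‖ ≤ ‖A' y‖ + ‖(A' - A) y‖ := by
    have : A y = A' y - (A' - A) y := by simp
    rw [this]
    exact norm_sub_le _ _
  linarith

lemma isClosed_range_of_bound_below [CompleteSpace E] {A : E →L[ℝ] F} {c : ℝ} (hc : 0 < c)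
    (h : ∀ y, c * ‖y‖ ≤ ‖A y‖) : IsClosed (Set.range A) := by
  refine (A.antilipschitz_of_bound (K := ⟨c⁻¹, by positivity⟩) fun x => ?_).isClosed_range
    A.uniformContinuous
  change ‖x‖ ≤ c⁻¹ * ‖A x‖
  rw [inv_mul_eq_div, le_div_iff₀ hc, mul_comm]
  exact h x

lemma exists_bound_below [CompleteSpace E] [CompleteSpace F] {A : E →L[ℝ] F}
    (hA : Function.Injective A) (hcl : IsClosed (Set.range A)) :
    ∃ c > 0, ∀ y, c * ‖y‖ ≤ ‖A y‖ := by
  obtain ⟨K, hK⟩ := A.antilipschitz_of_injective_of_isClosed_range hA hcl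
  refine ⟨((K : ℝ) + 1)⁻¹, by positivity, fun y => ?_⟩
  rw [inv_mul_le_iff₀ (by positivity)]
  have := A.bound_of_antilipschitz hK y
  nlinarith [norm_nonneg (A y)]

lemma norm_coprod_sub_coprod_le {G : Type*} [NormedAddCommGroup G] [NormedSpace ℝ G]
    (A A' : E →L[ℝ] F) (R : G →L[ℝ] F) : ‖A'.coprod R - A.coprod R‖ ≤ ‖A' - A‖ := by
  refine ContinuousLinearMap.opNorm_le_bound _ (norm_nonneg _) fun p => ?_
  have : (A'.coprod R - A.coprod R) p = (A' - A) p.1 := by simp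
  rw [this]
  exact ((A' - A).le_opNorm _).trans (by gcongr; exact norm_fst_le p)

end Perturbation

section Codimension

variable {E W G : Type*} [AddCommGroup E] [Module ℝ E] [AddCommGroup W] [Module ℝ W]
  [AddCommGroup G] [Module ℝ G]

lemma surjective_mkQ_comp_of_surjective_coprod {A : E →ₗ[ℝ] W} {R : G →ₗ[ℝ] W}
    (h : Function.Surjective (A.coprod R)) :
    Function.Surjective ((LinearMap.range A).mkQ ∘ₗ R) := by
  intro q
  obtain ⟨w, rfl⟩ := (LinearMap.range A).mkQ_surjective q
  obtain ⟨⟨e, g⟩, rfl⟩ := h w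
  refine ⟨g, ?_⟩
  simp only [LinearMap.comp_apply, LinearMap.coprod_apply, map_add]
  rw [right_eq_add, Submodule.mkQ_apply, Submodule.Quotient.mk_eq_zero]
  exact ⟨e, rfl⟩

variable [FiniteDimensional ℝ G]

lemma rank_quotient_range_le_of_surjective_coprod {A : E →ₗ[ℝ] W} {R : G →ₗ[ℝ] W}
    (h : Function.Surjective (A.coprod R)) :
    Module.rank ℝ (W ⧸ LinearMap.range A) ≤ Module.finrank ℝ G := by
  have := LinearMap.lift_rank_le_of_surjective _ (surjective_mkQ_comp_of_surjective_coprod h)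
  rwa [← Module.finrank_eq_rank ℝ G, Cardinal.lift_natCast, Cardinal.lift_le_nat_iff] at this

lemma finrank_le_rank_quotient_range_of_injective_coprod {A : E →ₗ[ℝ] W} {R : G →ₗ[ℝ] W}
    (h : Function.Injective (A.coprod R)) :
    (Module.finrank ℝ G : Cardinal) ≤ Module.rank ℝ (W ⧸ LinearMap.range A) := by
  have hi : Function.Injective ((LinearMap.range A).mkQ ∘ₗ R) := by
    rw [injective_iff_map_eq_zero]
    intro g hg
    rw [LinearMap.comp_apply, Submodule.mkQ_apply, Submodule.Quotient.mk_eq_zero] at hg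
    obtain ⟨e, he⟩ := hg
    have : A.coprod R (-e, g) = A.coprod R 0 := by simp [he]
    exact congrArg Prod.snd (h this)
  have := LinearMap.lift_rank_le_of_injective _ hi
  rwa [← Module.finrank_eq_rank ℝ G, Cardinal.lift_natCast, Cardinal.nat_le_lift_iff] at this

lemma exists_surjective_coprod {A : E →ₗ[ℝ] W} {n : ℕ}
    (h : Module.rank ℝ (W ⧸ LinearMap.range A) ≤ n) :
    ∃ R : (Fin n → ℝ) →ₗ[ℝ] W, Function.Surjective (A.coprod R) := by
  obtain ⟨f, hf⟩ := (lift_rank_le_iff_exists_linearMap (R := ℝ)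
    (M := W ⧸ LinearMap.range A) (M' := Fin n → ℝ)).1 (by simpa using h)
  obtain ⟨g, hg⟩ := f.exists_leftInverse_of_injective (LinearMap.ker_eq_bot.2 hf)
  obtain ⟨r, hr⟩ := (LinearMap.range A).mkQ.exists_rightInverse_of_surjective
    (LinearMap.range_eq_top.2 (LinearMap.range A).mkQ_surjective)
  refine ⟨r ∘ₗ g, fun w => ?_⟩
  set q := (LinearMap.range A).mkQ w with hq
  have h1 : (LinearMap.range A).mkQ (r q) = q := LinearMap.congr_fun hr q
  have h2 : g (f q) = q := LinearMap.congr_fun hg q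
  have h3 : w - r q ∈ LinearMap.range A := by
    rw [← Submodule.Quotient.mk_eq_zero, ← Submodule.mkQ_apply, map_sub, h1, sub_self]
  obtain ⟨e, he⟩ := h3
  exact ⟨(e, f q), by simp [h2, he]⟩

lemma exists_injective_coprod {A : E →ₗ[ℝ] W} (hA : Function.Injective A) {n : ℕ}
    (h : n ≤ Module.rank ℝ (W ⧸ LinearMap.range A)) :
    ∃ R : (Fin n → ℝ) →ₗ[ℝ] W, Function.Injective (A.coprod R) := by
  obtain ⟨f, hf⟩ := Module.le_rank_iff_exists_linearMap.1 h
  obtain ⟨r, hr⟩ := (LinearMap.range A).mkQ.exists_rightInverse_of_surjective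
    (LinearMap.range_eq_top.2 (LinearMap.range A).mkQ_surjective)
  refine ⟨r ∘ₗ f, (injective_iff_map_eq_zero _).2 ?_⟩
  rintro ⟨e, g⟩ heg
  simp only [LinearMap.coprod_apply, LinearMap.comp_apply] at heg
  have h1 : (LinearMap.range A).mkQ (r (f g)) = f g := LinearMap.congr_fun hr (f g)
  have h2 : (LinearMap.range A).mkQ (A e) = 0 := by
    rw [Submodule.mkQ_apply, Submodule.Quotient.mk_eq_zero]
    exact ⟨e, rfl⟩
  have h3 := congrArg (LinearMap.range A).mkQ heg
  rw [map_add, h1, h2, zero_add, map_zero] at h3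
  have hg : g = 0 := hf (by simpa using h3)
  subst hg
  have he : e = 0 := hA (by simpa using heg)
  simp [he]

end Codimension

section Family

variable {E W : Type*} [NormedAddCommGroup E] [NormedSpace ℝ E] [CompleteSpace E]
  [NormedAddCommGroup W] [NormedSpace ℝ W] [CompleteSpace W]

/-- The codimension of the range is locally constant on the set of bounded below operators. -/
lemma exists_near_rank_quotient_range_le_iff {A : E →L[ℝ] W} {c : ℝ} (hc : 0 < c)
    (h : ∀ y, c * ‖y‖ ≤ ‖A y‖) (n : ℕ) :
    ∃ δ > 0, ∀ A' : E →L[ℝ] W, ‖A' - A‖ ≤ δ →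
      (Module.rank ℝ (W ⧸ LinearMap.range A.toLinearMap) ≤ n ↔
        Module.rank ℝ (W ⧸ LinearMap.range A'.toLinearMap) ≤ n) := by
  by_cases hn : Module.rank ℝ (W ⧸ LinearMap.range A.toLinearMap) ≤ n
  · obtain ⟨R, hR⟩ := exists_surjective_coprod hn
    obtain ⟨C, -, δ, hδ, H⟩ :=
      exists_preimage_bound_of_near_surjective (A.coprod R.toContinuousLinearMap) hR
    refine ⟨δ, hδ, fun A' hA' => iff_of_true hn ?_⟩
    have hs : Function.Surjective (A'.toLinearMap.coprod R) := fun w =>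
      (H _ ((norm_coprod_sub_coprod_le A A' R.toContinuousLinearMap).trans hA') w).imp
        fun _ hy => hy.1
    simpa using rank_quotient_range_le_of_surjective_coprod hs
  · have hA : Function.Injective A := by
      rw [injective_iff_map_eq_zero]
      intro y hy
      have := h y
      rw [hy, norm_zero] at this
      exact norm_le_zero_iff.1 (nonpos_of_mul_nonpos_right this hc)
    have hn' : ((n + 1 : ℕ) : Cardinal) ≤
        Module.rank ℝ (W ⧸ LinearMap.range A.toLinearMap) := by
      rw [Nat.cast_add_one, Cardinal.natCast_add_one_le_iff]
      exact not_le.1 hn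
    obtain ⟨R, hR⟩ := exists_injective_coprod (A := A.toLinearMap) hA hn'
    have hcl : IsClosed (Set.range (A.coprod R.toContinuousLinearMap)) := by
      have := Submodule.isClosed_sup_finiteDimensional (LinearMap.range A.toLinearMap)
        (LinearMap.range R) (isClosed_range_of_bound_below hc h)
      rw [← LinearMap.range_coprod] at this
      exact this
    obtain ⟨d, hd, H⟩ := exists_bound_below hR hcl
    refine ⟨d / 2, by positivity, fun A' hA' => iff_of_false hn ?_⟩
    have hi : Function.Injective (A'.toLinearMap.coprod R) := by
      rw [injective_iff_map_eq_zero]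
      intro p hp
      have := bound_below_of_near (H p)
        ((norm_coprod_sub_coprod_le A A' R.toContinuousLinearMap).trans hA')
      have hp' : A'.coprod R.toContinuousLinearMap p = 0 := hp
      rw [hp', norm_zero] at this
      exact norm_le_zero_iff.1 (nonpos_of_mul_nonpos_right this (half_pos hd))
    have := finrank_le_rank_quotient_range_of_injective_coprod hi
    rw [Module.finrank_fin_fun, Nat.cast_add_one, Cardinal.natCast_add_one_le_iff] at this
    exact not_le.2 this

/-- Along a path of bounded below operators the codimension of the range is constant. -/
lemma rank_quotient_range_le_iff_of_path {A : ℝ → E →L[ℝ] W} (hA : Continuous A) {a b : ℝ}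
    (hab : a ≤ b) (h : ∀ t ∈ Set.Icc a b, ∃ c > 0, ∀ y, c * ‖y‖ ≤ ‖A t y‖) (n : ℕ) :
    Module.rank ℝ (W ⧸ LinearMap.range (A a).toLinearMap) ≤ n ↔
      Module.rank ℝ (W ⧸ LinearMap.range (A b).toLinearMap) ≤ n := by
  refine (isPreconnected_Icc (a := a) (b := b)).induction₂
    (fun s t => Module.rank ℝ (W ⧸ LinearMap.range (A s).toLinearMap) ≤ n ↔
      Module.rank ℝ (W ⧸ LinearMap.range (A t).toLinearMap) ≤ n) (fun t ht => ?_)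
    (fun _ _ _ _ _ _ h1 h2 => h1.trans h2) (fun _ _ _ _ h1 => h1.symm)
    (Set.left_mem_Icc.2 hab) (Set.right_mem_Icc.2 hab)
  obtain ⟨c, hc, hct⟩ := h t ht
  obtain ⟨δ, hδ, H⟩ := exists_near_rank_quotient_range_le_iff hc hct n
  filter_upwards [nhdsWithin_le_nhds (hA.continuousAt.preimage_mem_nhds
    (Metric.closedBall_mem_nhds (A t) hδ))] with s hs
  exact H (A s) (by simpa [dist_eq_norm] using hs)

end Family

section UpperSemiFredholm

variable {E F : Type*} [NormedAddCommGroup E] [NormedSpace ℝ E]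
  [NormedAddCommGroup F] [NormedSpace ℝ F]

/-- An operator is upper semi-Fredholm if it is bounded below on the common kernel of finitely
many continuous functionals. -/
def UpperSemiFredholm (A : E →L[ℝ] F) : Prop :=
  ∃ s : Finset (E →L[ℝ] ℝ), ∃ c > 0, ∀ y, (∀ f ∈ s, f y = 0) → c * ‖y‖ ≤ ‖A y‖

/-- Upper semi-Fredholm operators are bounded below on a common finite-codimensional subspace
along a compact path. -/
lemma exists_finset_bound_below_of_isCompact {A : ℝ → E →L[ℝ] F} (hA : Continuous A) {K : Set ℝ}
    (hK : IsCompact K) (h : ∀ t ∈ K, UpperSemiFredholm (A t)) :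
    ∃ s : Finset (E →L[ℝ] ℝ), ∃ c > 0, ∀ t ∈ K, ∀ y, (∀ f ∈ s, f y = 0) →
      c * ‖y‖ ≤ ‖A t y‖ := by
  classical
  refine hK.induction_on (p := fun K => ∃ s : Finset (E →L[ℝ] ℝ), ∃ c > 0, ∀ t ∈ K, ∀ y,
    (∀ f ∈ s, f y = 0) → c * ‖y‖ ≤ ‖A t y‖) ⟨∅, 1, one_pos, by simp⟩ ?_ ?_ ?_
  · rintro K L hKL ⟨s, c, hc, H⟩
    exact ⟨s, c, hc, fun t ht => H t (hKL ht)⟩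
  · rintro K L ⟨s, c, hc, H⟩ ⟨s', c', hc', H'⟩
    refine ⟨s ∪ s', min c c', lt_min hc hc', fun t ht y hy => ?_⟩
    rcases ht with ht | ht
    · exact le_trans (by gcongr; exact min_le_left _ _)
        (H t ht y fun f hf => hy f (Finset.mem_union_left _ hf))
    · exact le_trans (by gcongr; exact min_le_right _ _)
        (H' t ht y fun f hf => hy f (Finset.mem_union_right _ hf))
  · intro t ht
    obtain ⟨s, c, hc, H⟩ := h t ht
    refine ⟨_, nhdsWithin_le_nhds (hA.continuousAt.preimage_mem_nhds
      (Metric.closedBall_mem_nhds (A t) (half_pos hc))), s, c / 2, half_pos hc,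
      fun u hu y hy => bound_below_of_near (H y hy) (by simpa [dist_eq_norm] using hu)⟩

/-- Pairing an operator that is bounded below on a finite-codimensional kernel with the map
defining this kernel gives a bounded below operator. -/
lemma exists_bound_below_prod [CompleteSpace E] [CompleteSpace F] {G : Type*}
    [NormedAddCommGroup G] [NormedSpace ℝ G] [FiniteDimensional ℝ G] {A : E →L[ℝ] F}
    {Φ : E →L[ℝ] G} {c : ℝ} (hc : 0 < c) (h : ∀ y, Φ y = 0 → c * ‖y‖ ≤ ‖A y‖) :
    ∃ d > 0, ∀ y, d * ‖y‖ ≤ ‖A.prod Φ y‖ := by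
  have : CompleteSpace G := FiniteDimensional.complete ℝ G
  refine exists_bound_below ?_ ?_
  · rw [injective_iff_map_eq_zero]
    intro y hy
    have h1 : A y = 0 := congrArg Prod.fst hy
    have := h y (congrArg Prod.snd hy)
    rw [h1, norm_zero] at this
    exact norm_le_zero_iff.1 (nonpos_of_mul_nonpos_right this hc)
  · have : (LinearMap.ker Φ.toLinearMap).CoFG := Submodule.CoFG.ker _
    refine LinearMap.isClosed_range_of_isClosed_map_of_finiteDimensional_quotient
      (f := (A.prod Φ).toLinearMap) (s := LinearMap.ker Φ.toLinearMap) ?_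
    have hk : IsClosed (LinearMap.ker Φ.toLinearMap : Set E) := Φ.isClosed_ker
    have : CompleteSpace (LinearMap.ker Φ.toLinearMap) := hk.completeSpace_coe
    have hcl : IsClosed (Set.range
        ((A.prod Φ).comp (LinearMap.ker Φ.toLinearMap).subtypeL)) := by
      refine isClosed_range_of_bound_below hc fun y => (h y y.2).trans ?_
      exact norm_fst_le ((A.prod Φ) (y : E))
    convert hcl using 1
    ext w
    constructor
    · rintro ⟨y, hy, rfl⟩
      exact ⟨⟨y, hy⟩, rfl⟩
    · rintro ⟨y, rfl⟩
      exact ⟨y, y.2, rfl⟩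

/-- If `J` is injective, `S` is surjective and all `J + t S` with `t ≥ 0` are upper
semi-Fredholm, then `J` and `S` are bijective. -/
theorem surjective_and_injective_of_upperSemiFredholm [CompleteSpace E] [CompleteSpace F]
    {J S : E →L[ℝ] F} (hJ : Function.Injective J) (hS : Function.Surjective S)
    (h : ∀ t : ℝ, 0 ≤ t → UpperSemiFredholm (J + t • S)) :
    Function.Surjective J ∧ Function.Injective S := by
  obtain ⟨C, hC, δ, hδ, H⟩ := exists_preimage_bound_of_near_surjective S hS
  have key : ∀ ε : ℝ, 0 < ε → ε * ‖J‖ ≤ δ →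
      Function.Surjective J ∧ Function.Injective (S + ε • J) := by
    intro ε hε hεδ
    have hA : Continuous fun t : ℝ => J + t • S := by fun_prop
    have hε' : (0 : ℝ) ≤ ε⁻¹ := by positivity
    obtain ⟨s, c, hc, hs⟩ := exists_finset_bound_below_of_isCompact hA
      (isCompact_Icc (a := (0 : ℝ)) (b := ε⁻¹)) fun t ht => h t ht.1
    let Φ : E →L[ℝ] (s → ℝ) := ContinuousLinearMap.pi fun f => f.1
    let B : ℝ → E →L[ℝ] F × (s → ℝ) := fun t => (J + t • S).prod Φ
    have hB : Continuous B := by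
      have : B = fun t : ℝ => (ContinuousLinearMap.inl ℝ F (s → ℝ)).comp (J + t • S) +
          (ContinuousLinearMap.inr ℝ F (s → ℝ)).comp Φ := by
        funext t
        ext y <;> simp [B]
      rw [this]
      fun_prop
    have hbb : ∀ t ∈ Set.Icc 0 ε⁻¹, ∃ d > 0, ∀ y, d * ‖y‖ ≤ ‖B t y‖ := fun t ht =>
      exists_bound_below_prod hc fun y hy => hs t ht y fun f hf => congrFun hy ⟨f, hf⟩
    have hrank := rank_quotient_range_le_iff_of_path hB hε' hbb
    have hscale : ∀ y, (J + ε⁻¹ • S) y = ε⁻¹ • (S + ε • J) y := by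
      intro y
      simp [smul_smul, hε.ne', add_comm]
    have hsurj : Function.Surjective (J + ε⁻¹ • S) := by
      intro x
      obtain ⟨y, hy, -⟩ := H (S + ε • J) (by simpa [norm_smul, abs_of_pos hε] using hεδ) (ε • x)
      exact ⟨y, by rw [hscale, hy, smul_smul, inv_mul_cancel₀ hε.ne', one_smul]⟩
    have hcop : Function.Surjective
        ((B ε⁻¹).toLinearMap.coprod (LinearMap.inr ℝ F (s → ℝ))) := by
      rintro ⟨x, e⟩
      obtain ⟨y, rfl⟩ := hsurj x
      exact ⟨(y, e - Φ y), by ext <;> simp [B]⟩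
    have hle := rank_quotient_range_le_of_surjective_coprod hcop
    have hle0 := (hrank _).2 hle
    constructor
    · intro x
      by_contra! hx
      let R : (s → ℝ) × ℝ →ₗ[ℝ] F × (s → ℝ) :=
        ((LinearMap.toSpanSingleton ℝ F x).comp (LinearMap.snd ℝ _ _)).prod (LinearMap.fst ℝ _ _)
      have hR : Function.Injective ((B 0).toLinearMap.coprod R) := by
        rw [injective_iff_map_eq_zero]
        rintro ⟨y, e, r⟩ hy
        have h1 : J y + r • x = 0 := by simpa [B, R] using congrArg Prod.fst hy
        have h2 : Φ y + e = 0 := congrArg Prod.snd hy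
        have hr : r = 0 := by
          by_contra hr
          refine hx (-(r⁻¹ • y)) ?_
          rw [map_neg, map_smul, eq_neg_of_add_eq_zero_left h1, smul_neg, neg_neg, smul_smul,
            inv_mul_cancel₀ hr, one_smul]
        have hy : y = 0 := hJ (by simpa [hr] using h1)
        have he : e = 0 := by simpa [hy] using h2
        simp [hr, hy, he]
      have := (finrank_le_rank_quotient_range_of_injective_coprod hR).trans hle0
      rw [Nat.cast_le] at this
      simp at this
    · rw [injective_iff_map_eq_zero]
      intro y hy
      have hAy : (J + ε⁻¹ • S) y = 0 := by rw [hscale, hy, smul_zero]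
      have hR : Function.Injective
          ((B 0).toLinearMap.coprod (LinearMap.inr ℝ F (s → ℝ))) := by
        rw [injective_iff_map_eq_zero]
        rintro ⟨y, e⟩ hy
        have h1 : J y = 0 := by simpa [B] using congrArg Prod.fst hy
        have h2 : Φ y + e = 0 := congrArg Prod.snd hy
        have hy : y = 0 := hJ (by simpa using h1)
        have he : e = 0 := by simpa [hy] using h2
        simp [hy, he]
      have hge := finrank_le_rank_quotient_range_of_injective_coprod hR
      set p : (s → ℝ) →ₗ[ℝ] _ :=
        (LinearMap.range (B ε⁻¹).toLinearMap).mkQ ∘ₗ LinearMap.inr ℝ F (s → ℝ) with hp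
      have hps : Function.Surjective p := surjective_mkQ_comp_of_surjective_coprod hcop
      have : Module.Finite ℝ ((F × (s → ℝ)) ⧸ LinearMap.range (B ε⁻¹).toLinearMap) :=
        Module.Finite.of_surjective p hps
      have hfin : Module.finrank ℝ (s → ℝ) =
          Module.finrank ℝ ((F × (s → ℝ)) ⧸ LinearMap.range (B ε⁻¹).toLinearMap) := by
        refine le_antisymm ?_ (LinearMap.finrank_le_finrank_of_surjective hps)
        rw [← Nat.cast_le (α := Cardinal)]
        exact hge.trans ((hrank _).2 (Module.finrank_eq_rank ℝ _).ge)
      have hpi := (LinearMap.injective_iff_surjective_of_finrank_eq_finrank hfin).2 hps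
      have hΦ : Φ y = 0 := by
        refine hpi ?_
        rw [map_zero, hp, LinearMap.comp_apply, Submodule.mkQ_apply,
          Submodule.Quotient.mk_eq_zero]
        exact ⟨y, Prod.ext hAy rfl⟩
      obtain ⟨d, hd, hdb⟩ := hbb ε⁻¹ ⟨hε', le_rfl⟩
      have h0 := hdb y
      have : B ε⁻¹ y = 0 := Prod.ext hAy hΦ
      rw [this, norm_zero] at h0
      exact norm_le_zero_iff.1 (nonpos_of_mul_nonpos_right h0 hd)
  set N : ℝ := ‖J‖ + 1
  have hN : 0 < N := by positivity
  have hJN : ‖J‖ ≤ N := by simp [N]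
  set ε : ℝ := min (δ / N) (1 / (2 * C * N))
  have hε : 0 < ε := lt_min (by positivity) (by positivity)
  have hε1 : ε * ‖J‖ ≤ δ := by
    calc ε * ‖J‖ ≤ δ / N * N := by gcongr; exact min_le_left _ _
      _ = δ := by field_simp
  obtain ⟨hJs, hinj⟩ := key ε hε hε1
  refine ⟨hJs, (injective_iff_map_eq_zero _).2 fun z hz => ?_⟩
  obtain ⟨y, hy, hyb⟩ := H (S + ε • J) (by simpa [norm_smul, abs_of_pos hε] using hε1)
    ((S + ε • J) z)
  rw [hinj hy] at hyb
  have h1 : ‖(S + ε • J) z‖ ≤ ε * (N * ‖z‖) := by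
    have : (S + ε • J) z = ε • J z := by simp [hz]
    rw [this, norm_smul, Real.norm_of_nonneg hε.le]
    gcongr
    exact (J.le_opNorm z).trans (by gcongr)
  have h2 : C * (ε * (N * ‖z‖)) ≤ ‖z‖ / 2 := by
    calc C * (ε * (N * ‖z‖)) ≤ C * (1 / (2 * C * N) * (N * ‖z‖)) := by
          gcongr
          exact min_le_right _ _
      _ = ‖z‖ / 2 := by field_simp
  have h3 : ‖z‖ ≤ ‖z‖ / 2 := hyb.trans ((by gcongr : _ ≤ C * (ε * (N * ‖z‖))).trans h2)
  exact norm_le_zero_iff.1 (by linarith)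

end UpperSemiFredholm

section HereditarilyIndecomposable

lemma exists_biorthogonal_sequence {E F : Type*} [NormedAddCommGroup E] [NormedSpace ℝ E]
    [NormedAddCommGroup F] [NormedSpace ℝ F] {A : E →L[ℝ] F} (hA : ¬UpperSemiFredholm A)
    {ε : ℝ} (hε : 0 < ε) :
    ∃ (x : ℕ → E) (f : ℕ → E →L[ℝ] ℝ), (∀ n, ‖x n‖ = 1) ∧ (∀ n, ‖f n‖ ≤ 1) ∧
      (∀ n, f n (x n) = 1) ∧ (∀ m n, m < n → f m (x n) = 0) ∧
      ∀ n, ‖A (x n)‖ ≤ ε * (1 / 4) ^ n := by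
  classical
  obtain ⟨u, hu, hr⟩ := exists_seq_of_forall_finset_exists (α := E × (E →L[ℝ] ℝ) × ℝ)
    (fun p => ‖p.1‖ = 1 ∧ ‖p.2.1‖ ≤ 1 ∧ p.2.1 p.1 = 1 ∧ ‖A p.1‖ ≤ p.2.2 ∧ 0 < p.2.2 ∧ p.2.2 ≤ ε)
    (fun p q => p.2.1 q.1 = 0 ∧ q.2.2 ≤ p.2.2 / 4) (fun s hs => by
      obtain ⟨d, hd, hdε, hds⟩ : ∃ d : ℝ, 0 < d ∧ d ≤ ε ∧ ∀ p ∈ s, d ≤ p.2.2 / 4 := by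
        have h1 : ∀ᶠ d : ℝ in 𝓝[>] 0, d ≤ ε :=
          nhdsWithin_le_nhds (eventually_le_nhds hε)
        have h2 : ∀ᶠ d : ℝ in 𝓝[>] 0, ∀ p ∈ s, d ≤ p.2.2 / 4 :=
          (Filter.eventually_all_finset s).2 fun p hp =>
            nhdsWithin_le_nhds (eventually_le_nhds (by linarith [(hs p hp).2.2.2.2.1]))
        obtain ⟨d, hd, h1, h2⟩ := (eventually_mem_nhdsWithin.and (h1.and h2)).exists
        exact ⟨d, hd, h1, h2⟩
      unfold UpperSemiFredholm at hA
      push Not at hA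
      obtain ⟨y, hy, hAy⟩ := hA (s.image fun p => p.2.1) d hd
      have hy0 : 0 < ‖y‖ := by
        by_contra! h
        have : ‖y‖ = 0 := le_antisymm h (norm_nonneg _)
        rw [this, mul_zero] at hAy
        exact absurd hAy (norm_nonneg _).not_gt
      have hx : ‖‖y‖⁻¹ • y‖ = 1 := by
        rw [norm_smul, norm_inv, norm_norm, inv_mul_cancel₀ hy0.ne']
      obtain ⟨f, hf, hfx⟩ := exists_dual_vector'' ℝ (‖y‖⁻¹ • y)
      refine ⟨(‖y‖⁻¹ • y, f, d), ⟨hx, hf, by simpa [hx] using hfx, ?_, hd, hdε⟩, fun p hp =>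
        ⟨?_, hds p hp⟩⟩
      · rw [map_smul, norm_smul, norm_inv, norm_norm, inv_mul_le_iff₀ hy0, mul_comm]
        exact hAy.le
      · simp [hy _ (Finset.mem_image_of_mem _ hp)])
  refine ⟨fun n => (u n).1, fun n => (u n).2.1, fun n => (hu n).1, fun n => (hu n).2.1,
    fun n => (hu n).2.2.1, fun m n h => (hr m n h).1, fun n => (hu n).2.2.2.1.trans ?_⟩
  induction n with
  | zero => simpa using (hu 0).2.2.2.2.2
  | succ n ih =>
    have := (hr n (n + 1) n.lt_succ_self).2
    rw [pow_succ]
    linarith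

lemma abs_coeff_le_of_biorthogonal {E : Type*} [NormedAddCommGroup E] [NormedSpace ℝ E]
    {x : ℕ → E} {f : ℕ → E →L[ℝ] ℝ} (hx : ∀ n, ‖x n‖ = 1) (hf : ∀ n, ‖f n‖ ≤ 1)
    (hfx : ∀ n, f n (x n) = 1) (hfx0 : ∀ m n, m < n → f m (x n) = 0) (a : ℕ →₀ ℝ) (n : ℕ) :
    |a n| ≤ 2 ^ n * ‖Finsupp.linearCombination ℝ x a‖ := by
  set w := Finsupp.linearCombination ℝ x a with hw
  have hstep : ∀ n, |a n| ≤ ‖w‖ + ∑ k ∈ Finset.range n, |a k| := by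
    intro n
    have hw' : w = ∑ k ∈ Finset.range (a.support.sup id + 1 + (n + 1)), a k • x k := by
      rw [hw, Finsupp.linearCombination_apply]
      refine Finsupp.sum_of_support_subset _ (fun k hk => ?_) _ (by simp)
      have : k ≤ a.support.sup id := Finset.le_sup (f := id) hk
      rw [Finset.mem_range]
      omega
    have hfw : f n w = ∑ k ∈ Finset.range n, a k * f n (x k) + a n := by
      rw [hw', map_sum, ← Finset.sum_subset (Finset.range_mono (by omega : n + 1 ≤ _)),
        Finset.sum_range_succ]
      · simp [hfx]
      · intro k _ hk
        rw [map_smul, hfx0 n k (by simpa using hk), smul_zero]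
    have h1 : |f n w| ≤ ‖w‖ := by
      simpa using ((f n).le_of_opNorm_le (hf n) w)
    have h2 : |∑ k ∈ Finset.range n, a k * f n (x k)| ≤ ∑ k ∈ Finset.range n, |a k| := by
      refine (Finset.abs_sum_le_sum_abs _ _).trans (Finset.sum_le_sum fun k _ => ?_)
      have : |f n (x k)| ≤ 1 := by
        simpa [hx] using ((f n).le_of_opNorm_le (hf n) (x k))
      rw [abs_mul]
      exact mul_le_of_le_one_right (abs_nonneg _) this
    have h3 : a n = f n w - ∑ k ∈ Finset.range n, a k * f n (x k) := by rw [hfw]; ring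
    calc |a n| ≤ |f n w| + |∑ k ∈ Finset.range n, a k * f n (x k)| := by
          rw [h3]; exact abs_sub _ _
      _ ≤ _ := add_le_add h1 h2
  have hsum : ∀ n, ∑ k ∈ Finset.range n, |a k| ≤ (2 ^ n - 1) * ‖w‖ := by
    intro n
    induction n with
    | zero => simp
    | succ n ih =>
      rw [Finset.sum_range_succ, pow_succ]
      linarith [hstep n]
  linarith [hstep n, hsum n]

/-- An operator that is not upper semi-Fredholm has arbitrarily small restrictions to
infinite-dimensional subspaces. -/
lemma exists_infinite_dimensional_small {E F : Type*} [NormedAddCommGroup E] [NormedSpace ℝ E]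
    [NormedAddCommGroup F] [NormedSpace ℝ F] {A : E →L[ℝ] F} (hA : ¬UpperSemiFredholm A)
    {ε : ℝ} (hε : 0 < ε) :
    ∃ W : Submodule ℝ E, ¬FiniteDimensional ℝ W ∧ ∀ w ∈ W, ‖A w‖ ≤ ε * ‖w‖ := by
  obtain ⟨x, f, hx, hf, hfx, hfx0, hAx⟩ := exists_biorthogonal_sequence hA (half_pos hε)
  have hcoeff := abs_coeff_le_of_biorthogonal hx hf hfx hfx0
  have hli : LinearIndependent ℝ x := by
    rw [linearIndependent_iff]
    intro a ha
    ext n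
    have := hcoeff a n
    rw [ha, norm_zero, mul_zero] at this
    exact abs_nonpos_iff.1 this
  refine ⟨Submodule.span ℝ (Set.range x), fun hfin => ?_, fun w hw => ?_⟩
  · have := (linearIndependent_span hli).finite_of_isNoetherian
    exact not_finite ℕ
  · obtain ⟨a, rfl⟩ := Finsupp.mem_span_range_iff_exists_finsupp.1 hw
    have hc := hcoeff a
    rw [Finsupp.linearCombination_apply] at hc
    set w := a.sum fun i c => c • x i with hwdef
    have hw' : w = ∑ k ∈ Finset.range (a.support.sup id + 1), a k • x k := by
      refine Finsupp.sum_of_support_subset _ (fun k hk => ?_) _ (by simp)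
      have : k ≤ a.support.sup id := Finset.le_sup (f := id) hk
      rw [Finset.mem_range]
      omega
    calc ‖A w‖ ≤ ∑ k ∈ Finset.range (a.support.sup id + 1), ε / 2 * ‖w‖ * (1 / 2) ^ k := by
          conv_lhs => rw [hw', map_sum]
          refine norm_sum_le_of_le _ fun k _ => ?_
          rw [map_smul, norm_smul, Real.norm_eq_abs]
          calc |a k| * ‖A (x k)‖ ≤ 2 ^ k * ‖w‖ * (ε / 2 * (1 / 4) ^ k) := by
                gcongr
                exacts [hc k, hAx k]
            _ = ε / 2 * ‖w‖ * (2 ^ k * (1 / 4) ^ k) := by ring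
            _ = ε / 2 * ‖w‖ * (1 / 2) ^ k := by rw [← mul_pow]; norm_num
      _ ≤ ε / 2 * ‖w‖ * 2 := by
          rw [← Finset.mul_sum]
          gcongr
          exact sum_geometric_two_le _
      _ = ε * ‖w‖ := by ring

variable {X : Type*} [NormedAddCommGroup X] [NormedSpace ℝ X] [CompleteSpace X]

/-- In a hereditarily indecomposable space, two infinite-dimensional closed subspaces are never
at positive angle. -/
lemma IsHI.exists_norm_add_lt_of_isClosed (hHI : IsHI X) {U V : Submodule ℝ X}
    (hUcl : IsClosed (U : Set X)) (hVcl : IsClosed (V : Set X))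
    (hU : ¬FiniteDimensional ℝ U) (hV : ¬FiniteDimensional ℝ V) {C : ℝ} (hC : 0 < C) :
    ∃ u ∈ U, ∃ v ∈ V, C * ‖u + v‖ < ‖u‖ := by
  by_contra! h
  have : CompleteSpace U := hUcl.completeSpace_coe
  have : CompleteSpace V := hVcl.completeSpace_coe
  have hcl : IsClosed ((U ⊔ V : Submodule ℝ X) : Set X) := by
    have hr : IsClosed (Set.range (U.subtypeL.coprod V.subtypeL)) := by
      refine isClosed_range_of_bound_below (c := (1 + C)⁻¹) (by positivity) fun p => ?_
      rw [inv_mul_le_iff₀ (by positivity)]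
      have h1 := h p.1 p.1.2 p.2 p.2.2
      have h2 : ‖(p.2 : X)‖ ≤ ‖(p.1 : X) + p.2‖ + ‖(p.1 : X)‖ := by
        have : (p.2 : X) = ((p.1 : X) + p.2) - p.1 := by abel
        conv_lhs => rw [this]
        exact norm_sub_le _ _
      refine max_le ?_ ?_
      · change ‖(p.1 : X)‖ ≤ (1 + C) * ‖(p.1 : X) + p.2‖
        linarith [norm_nonneg ((p.1 : X) + p.2)]
      · change ‖(p.2 : X)‖ ≤ (1 + C) * ‖(p.1 : X) + p.2‖
        linarith
    convert hr using 1
    ext z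
    simp [Submodule.mem_sup]
  set T := U ⊔ V
  have hsup : U.comap T.subtype ⊔ V.comap T.subtype = ⊤ := by
    rw [eq_top_iff]
    rintro ⟨z, hz⟩ -
    obtain ⟨u, hu, v, hv, rfl⟩ := Submodule.mem_sup.1 hz
    exact Submodule.mem_sup.2 ⟨⟨u, Submodule.mem_sup_left hu⟩, hu,
      ⟨v, Submodule.mem_sup_right hv⟩, hv, rfl⟩
  refine hHI.2 T hcl ⟨U.comap T.subtype, V.comap T.subtype,
    hUcl.preimage continuous_subtype_val, hVcl.preimage continuous_subtype_val,
    fun hfin => hU (Submodule.comapSubtypeEquivOfLe (le_sup_left : U ≤ T)).finiteDimensional,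
    fun hfin => hV (Submodule.comapSubtypeEquivOfLe (le_sup_right : V ≤ T)).finiteDimensional,
    hsup, ?_, ?_, C, fun u hu v hv => h u hu v hv⟩
  · rw [eq_bot_iff]
    rintro ⟨z, hz⟩ ⟨hzU, hzV⟩
    have := h z hzU (-z) (V.neg_mem hzV)
    rw [add_neg_cancel, norm_zero, mul_zero, norm_le_zero_iff] at this
    subst this
    exact Submodule.zero_mem _
  · rw [hsup]
    exact isClosed_univ

lemma IsHI.exists_norm_add_lt (hHI : IsHI X) {U V : Submodule ℝ X}
    (hU : ¬FiniteDimensional ℝ U) (hV : ¬FiniteDimensional ℝ V) {C : ℝ} (hC : 0 < C) :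
    ∃ u ∈ U, ∃ v ∈ V, C * ‖u + v‖ < ‖u‖ := by
  by_contra! h
  have hfin : ∀ W : Submodule ℝ X, ¬FiniteDimensional ℝ W →
      ¬FiniteDimensional ℝ W.topologicalClosure := fun W hW hfin =>
    hW (Submodule.finiteDimensional_of_le W.le_topologicalClosure)
  obtain ⟨u, hu, v, hv, huv⟩ := hHI.exists_norm_add_lt_of_isClosed
    U.isClosed_topologicalClosure V.isClosed_topologicalClosure (hfin U hU) (hfin V hV) hC
  have hcl : IsClosed {p : X × X | ‖p.1‖ ≤ C * ‖p.1 + p.2‖} :=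
    isClosed_le (by fun_prop) (by fun_prop)
  have hmem : (u, v) ∈ closure ((U : Set X) ×ˢ (V : Set X)) := by
    rw [closure_prod_eq]
    exact ⟨hu, hv⟩
  have := closure_minimal (fun p hp => h p.1 hp.1 p.2 hp.2) hcl hmem
  exact huv.not_ge this

/-- For an isometric operator `J` into a hereditarily indecomposable space, at most one of the
operators `J + t S` fails to be upper semi-Fredholm. -/
lemma IsHI.eq_of_not_upperSemiFredholm (hHI : IsHI X) {E : Type*} [NormedAddCommGroup E]
    [NormedSpace ℝ E] {J S : E →L[ℝ] X} (hJ : ∀ y, ‖J y‖ = ‖y‖) {s t : ℝ}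
    (hs : ¬UpperSemiFredholm (J + s • S)) (ht : ¬UpperSemiFredholm (J + t • S)) : s = t := by
  by_contra hst
  set d := |t - s| with hd
  have hd0 : 0 < d := abs_pos.2 (sub_ne_zero.2 (Ne.symm hst))
  set ε := d / (4 * (|t| + 2 * |s| + 1)) with hεd
  have hε : 0 < ε := by positivity
  set C := 1 + 4 * |s| * ‖J + t • S‖ / d with hCd
  have hC : 1 ≤ C := by
    rw [hCd]
    have : 0 ≤ 4 * |s| * ‖J + t • S‖ / d := by positivity
    linarith
  obtain ⟨W₁, hW₁, h₁⟩ := exists_infinite_dimensional_small hs hε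
  obtain ⟨W₂, hW₂, h₂⟩ := exists_infinite_dimensional_small ht hε
  have hJi : Function.Injective J.toLinearMap := by
    rw [injective_iff_map_eq_zero]
    intro y hy
    rw [← norm_eq_zero, ← hJ y]
    exact norm_eq_zero.2 hy
  have hmap : ∀ W : Submodule ℝ E, ¬FiniteDimensional ℝ W →
      ¬FiniteDimensional ℝ (W.map J.toLinearMap) := fun W hW _ =>
    hW (Submodule.equivMapOfInjective _ hJi W).symm.finiteDimensional
  obtain ⟨_, ⟨w, hw, rfl⟩, _, ⟨v, hv, rfl⟩, hwv⟩ :=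
    hHI.exists_norm_add_lt (hmap W₁ hW₁) (hmap W₂ hW₂) (zero_lt_one.trans_le hC)
  replace hwv : C * ‖w + v‖ < ‖w‖ := by
    simpa [← map_add, hJ] using hwv
  have hv' : ‖v‖ ≤ 2 * ‖w‖ := by
    have : v = (w + v) - w := by abel
    have h3 : ‖v‖ ≤ ‖w + v‖ + ‖w‖ := by
      conv_lhs => rw [this]
      exact norm_sub_le _ _
    nlinarith [norm_nonneg (w + v)]
  have hw0 : 0 < ‖w‖ := lt_of_le_of_lt (by positivity) hwv
  have hkey : (t - s) • J w =
      t • (J + s • S) w - s • ((J + t • S) (w + v) - (J + t • S) v) := by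
    simp only [map_add, add_apply, smul_apply]
    module
  have h4 : d * ‖w‖ ≤ |t| * (ε * ‖w‖) + |s| * (‖J + t • S‖ * ‖w + v‖ + ε * ‖v‖) := by
    rw [hd, ← hJ w, ← Real.norm_eq_abs, ← norm_smul, hkey, hJ w]
    refine (norm_sub_le _ _).trans ?_
    rw [norm_smul, norm_smul, Real.norm_eq_abs, Real.norm_eq_abs]
    gcongr
    · exact h₁ w hw
    · exact (norm_sub_le _ _).trans (add_le_add (ContinuousLinearMap.le_opNorm _ _) (h₂ v hv))
  have h5 : |s| * (‖J + t • S‖ * ‖w + v‖) ≤ d / 4 * ‖w‖ := by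
    have : |s| * ‖J + t • S‖ = d / 4 * (C - 1) := by
      rw [hCd]
      field_simp
      ring
    rw [← mul_assoc, this, mul_assoc]
    gcongr
    nlinarith [norm_nonneg (w + v)]
  have h6 : ε * (|t| + 2 * |s|) ≤ d / 4 := by
    rw [hεd, div_mul_eq_mul_div, div_le_div_iff₀ (by positivity) (by norm_num)]
    nlinarith
  have h7 : |s| * (ε * ‖v‖) ≤ |s| * (ε * (2 * ‖w‖)) := by gcongr
  have h8 := mul_le_mul_of_nonneg_right h6 hw0.le
  have h9 : 0 < d * ‖w‖ := by positivity
  linarith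

/-- A surjection from a closed subspace onto a hereditarily indecomposable space is a bijection,
and the subspace is the whole space. -/
theorem IsHI.eq_top_and_injective_of_surjective (hHI : IsHI X) {Y : Submodule ℝ X}
    (hY : IsClosed (Y : Set X)) {S : Y →L[ℝ] X} (hS : Function.Surjective S) :
    Y = ⊤ ∧ Function.Injective S := by
  have : CompleteSpace Y := hY.completeSpace_coe
  have hJ : Function.Injective Y.subtypeL := Subtype.val_injective
  have htop : Function.Surjective Y.subtypeL → Y = ⊤ := fun h => by
    rw [eq_top_iff]
    rintro x -
    obtain ⟨y, rfl⟩ := h x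
    exact y.2
  by_cases h : ∀ t : ℝ, 0 ≤ t → UpperSemiFredholm (Y.subtypeL + t • S)
  · exact (surjective_and_injective_of_upperSemiFredholm hJ hS h).imp_left htop
  by_cases h' : ∀ t : ℝ, 0 ≤ t → UpperSemiFredholm (Y.subtypeL + t • (-S))
  · have hS' : Function.Surjective (-S) := fun x => by
      obtain ⟨y, hy⟩ := hS (-x)
      exact ⟨y, by simp [hy]⟩
    obtain ⟨h1, h2⟩ := surjective_and_injective_of_upperSemiFredholm hJ hS' h'
    exact ⟨htop h1, fun a b hab => h2 (by simp [hab])⟩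
  push Not at h h'
  obtain ⟨s, hs0, hs⟩ := h
  obtain ⟨t, ht0, ht⟩ := h'
  rw [smul_neg, ← neg_smul] at ht
  have hst := hHI.eq_of_not_upperSemiFredholm (fun _ => rfl) hs ht
  have h0 : s = 0 := by linarith
  subst h0
  exact absurd ⟨∅, 1, one_pos, fun y _ => by simp⟩ hs

end HereditarilyIndecomposable

/-- If `X` is an infinite-dimensional hereditarily indecomposable Banach space, then `X` is
isomorphic to no proper quotient of subspace of itself: for closed subspaces `Z ⊆ Y ⊆ X` with
`(Y, Z) ≠ (X, {0})`, there is no bounded linear bijection from `X` onto the quotient `Y/Z`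
(the quotient carrying the quotient norm). -/
theorem HI_not_isomorphic_to_proper_QS (X : Type*) [NormedAddCommGroup X] [NormedSpace ℝ X]
    [CompleteSpace X] (hX : ¬FiniteDimensional ℝ X) (hHI : IsHI X)
    (Y Z : Submodule ℝ X) (hZY : Z ≤ Y)
    (hYcl : IsClosed (Y : Set X)) (hZcl : IsClosed (Z : Set X))
    (hproper : ¬(Y = ⊤ ∧ Z = ⊥)) :
    ¬ ∃ T : X →ₗ[ℝ] (↥Y ⧸ Z.comap Y.subtype), Continuous T ∧ Function.Bijective T := by
  rintro ⟨T, hTc, hT⟩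
  have : CompleteSpace Y := hYcl.completeSpace_coe
  have hK : IsClosed (Z.comap Y.subtype : Set Y) := hZcl.preimage continuous_subtype_val
  let e := LinearEquiv.ofBijective T hT
  let S₀ : Y →ₗ[ℝ] X := e.symm.toLinearMap ∘ₗ (Z.comap Y.subtype).mkQ
  have hTS : ∀ y, T (S₀ y) = (Z.comap Y.subtype).mkQ y := fun y => e.apply_symm_apply _
  have hgraph : IsClosed (S₀.graph : Set (Y × X)) := by
    have : (S₀.graph : Set (Y × X)) =
        (fun p : Y × X => T p.2 - (Z.comap Y.subtype).mkQ p.1) ⁻¹' {0} := by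
      ext p
      rw [Set.mem_preimage, Set.mem_singleton_iff, sub_eq_zero, ← hTS, hT.1.eq_iff]
      exact S₀.mem_graph_iff p
    rw [this]
    have hq : Continuous (Z.comap Y.subtype).mkQ := continuous_quot_mk
    exact isClosed_singleton.preimage
      ((hTc.comp continuous_snd).sub (hq.comp continuous_fst))
  let S : Y →L[ℝ] X := ⟨S₀, S₀.continuous_of_isClosed_graph hgraph⟩
  have hS : Function.Surjective S :=
    e.symm.surjective.comp (Z.comap Y.subtype).mkQ_surjective
  obtain ⟨hYtop, hinj⟩ := hHI.eq_top_and_injective_of_surjective hYcl hS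
  refine hproper ⟨hYtop, (Submodule.eq_bot_iff Z).2 fun z hz => ?_⟩
  have hz0 : S ⟨z, hZY hz⟩ = 0 := by
    refine hT.1 ((hTS _).trans ?_)
    rw [map_zero, Submodule.mkQ_apply, Submodule.Quotient.mk_eq_zero]
    exact hz
  exact congrArg Subtype.val (hinj (hz0.trans (map_zero S).symm))

end
end

section
/- Let X be a Banach space with a finite-dimensional decomposition. The following are equivalent: (i) no infinite-dimensional FDD-block quotient of subspace of X is decomposable; (ii) for every infinite-codimensional FDD-block subspace Y of X, the quotient X/Y is hereditarily indecomposable; (iii) whenever Y = Σ_n F_n / Σ_n G_n and Y' = Σ_n F'_n / Σ_n G_n are infinite-dimensional FDD-block quotients of subspaces of X with the same successive partition (E_n) and the same subspaces G_n, the images of Y and Y' in X/Σ_n G_n do not form a topological direct sum. -/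
open Filter Topology

noncomputable section

/-- A finite-dimensional decomposition (FDD) of a Banach space: a sequence of nonzero
finite-dimensional subspaces such that every vector has a unique norm-convergent
expansion `x = Σ b n` with `b n ∈ B n`. -/
def IsFDD {E : Type*} [SeminormedAddCommGroup E] [NormedSpace ℝ E]
    (B : ℕ → Submodule ℝ E) : Prop :=
  (∀ n, B n ≠ ⊥) ∧ (∀ n, FiniteDimensional ℝ (B n)) ∧
    ∀ x : E, ∃! b : (n : ℕ) → B n,
      Tendsto (fun N => ∑ n ∈ Finset.range N, ((b n : E))) atTop (𝓝 x)

/-- A successive partition of `ℕ` into intervals, encoded by its sequence of left endpoints: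
the `n`-th interval is `[k n, k (n+1))`. -/
def SuccPartition (k : ℕ → ℕ) : Prop :=
  StrictMono k ∧ k 0 = 0

/-- An FDD-block subspace of a space with FDD `B`: the closed span of a sequence of
finitely supported (possibly zero) subspaces `F n` with `ran (F n) ⊆ E n` for some
successive partition. -/
def IsFDDBlockSubspace {E : Type*} [SeminormedAddCommGroup E] [NormedSpace ℝ E]
    (B : ℕ → Submodule ℝ E) (Y : Submodule ℝ E) : Prop :=
  ∃ k : ℕ → ℕ, SuccPartition k ∧ ∃ F : ℕ → Submodule ℝ E,
    (∀ n, F n ≤ ⨆ i ∈ Finset.Ico (k n) (k (n + 1)), B i) ∧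
    Y = (⨆ n, F n).topologicalClosure

/-- The FDD-block quotient of subspace `Σ F n / Σ G n`, as a quotient Banach space. -/
abbrev fddQS {E : Type*} [SeminormedAddCommGroup E] [NormedSpace ℝ E]
    (F G : ℕ → Submodule ℝ E) : Type _ :=
  ↥((⨆ n, F n).topologicalClosure) ⧸
    (((⨆ n, G n).topologicalClosure).comap ((⨆ n, F n).topologicalClosure).subtype)

/-- The restricted QHI property of a space with FDD `B`: no infinite-dimensional
FDD-block quotient of subspace is decomposable. -/
def RestrictedQHI {E : Type*} [SeminormedAddCommGroup E] [NormedSpace ℝ E]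
    (B : ℕ → Submodule ℝ E) : Prop :=
  ∀ k : ℕ → ℕ, SuccPartition k →
    ∀ F G : ℕ → Submodule ℝ E, (∀ n, G n ≤ F n) →
      (∀ n, F n ≤ ⨆ i ∈ Finset.Ico (k n) (k (n + 1)), B i) →
      ¬FiniteDimensional ℝ (fddQS F G) → ¬ Decomposable (fddQS F G)

end

noncomputable section

/-- The space of sequences of partial sums of convergent expansions along `B`, together with
their limits, as continuous functions on the one-point compactification of `ℕ`. -/
def partialSums {X : Type*} [NormedAddCommGroup X] [NormedSpace ℝ X] (B : ℕ → Submodule ℝ X) :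
    Submodule ℝ C(OnePoint ℕ, X) where
  carrier := {f | f ((0 : ℕ) : OnePoint ℕ) = 0 ∧
    ∀ n : ℕ, f ((n + 1 : ℕ) : OnePoint ℕ) - f (n : OnePoint ℕ) ∈ B n}
  zero_mem' := by simp
  add_mem' := by
    rintro f g ⟨hf, hf'⟩ ⟨hg, hg'⟩
    refine ⟨by simp [hf, hg], fun n => ?_⟩
    have := (B n).add_mem (hf' n) (hg' n)
    rw [ContinuousMap.add_apply, ContinuousMap.add_apply, add_sub_add_comm]
    exact this
  smul_mem' := by
    rintro c f ⟨hf, hf'⟩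
    refine ⟨by simp [hf], fun n => ?_⟩
    rw [ContinuousMap.smul_apply, ContinuousMap.smul_apply, ← smul_sub]
    exact (B n).smul_mem c (hf' n)

theorem isClosed_partialSums {X : Type*} [NormedAddCommGroup X] [NormedSpace ℝ X]
    {B : ℕ → Submodule ℝ X} (hB : ∀ n, FiniteDimensional ℝ (B n)) :
    IsClosed (partialSums B : Set C(OnePoint ℕ, X)) := by
  have : (partialSums B : Set C(OnePoint ℕ, X)) = {f | f ((0 : ℕ) : OnePoint ℕ) = 0} ∩
      ⋂ n : ℕ, {f | f ((n + 1 : ℕ) : OnePoint ℕ) - f (n : OnePoint ℕ) ∈ (B n : Set X)} := by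
    ext f
    simp [partialSums]
  rw [this]
  refine (isClosed_eq (by fun_prop) (by fun_prop)).inter (isClosed_iInter fun n => ?_)
  have := hB n
  exact (B n).closed_of_finiteDimensional.preimage
    (f := fun f : C(OnePoint ℕ, X) => f ((n + 1 : ℕ) : OnePoint ℕ) - f (n : OnePoint ℕ))
    (by fun_prop)

/-- Evaluation of the partial sums at infinity, that is, the sum of the expansion. -/
def partialSumsLimit {X : Type*} [NormedAddCommGroup X] [NormedSpace ℝ X]
    (B : ℕ → Submodule ℝ X) : partialSums B →L[ℝ] X :=
  (ContinuousMap.evalCLM ℝ (OnePoint.infty : OnePoint ℕ)).comp (partialSums B).subtypeL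

theorem tendsto_partialSums {X : Type*} [NormedAddCommGroup X] (f : C(OnePoint ℕ, X)) :
    Tendsto (fun n : ℕ => f (n : OnePoint ℕ)) atTop (𝓝 (f OnePoint.infty)) := by
  have h := (f.continuous.tendsto OnePoint.infty).comp (OnePoint.tendsto_coe_infty (X := ℕ))
  rwa [Filter.coclosedCompact_eq_cocompact, cocompact_eq_cofinite, Nat.cofinite_eq_atTop] at h

theorem sum_range_partialSums {X : Type*} [NormedAddCommGroup X] [NormedSpace ℝ X]
    {B : ℕ → Submodule ℝ X} (f : partialSums B) (N : ℕ) :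
    ∑ n ∈ Finset.range N, (f.1 ((n + 1 : ℕ) : OnePoint ℕ) - f.1 (n : OnePoint ℕ)) =
      f.1 (N : OnePoint ℕ) := by
  rw [Finset.sum_range_sub (fun n : ℕ => f.1 (n : OnePoint ℕ)), f.2.1, sub_zero]

theorem exists_partialSums {X : Type*} [NormedAddCommGroup X] [NormedSpace ℝ X]
    {B : ℕ → Submodule ℝ X} {b : (n : ℕ) → B n} {x : X}
    (h : Tendsto (fun N => ∑ n ∈ Finset.range N, (b n : X)) atTop (𝓝 x)) :
    ∃ f : partialSums B, partialSumsLimit B f = x ∧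
      ∀ N : ℕ, f.1 (N : OnePoint ℕ) = ∑ n ∈ Finset.range N, (b n : X) := by
  refine ⟨⟨OnePoint.continuousMapMkNat (fun N => ∑ n ∈ Finset.range N, (b n : X)) x h, ?_, ?_⟩,
    ?_, ?_⟩
  · exact Finset.sum_range_zero fun n => (b n : X)
  · intro n
    change (∑ i ∈ Finset.range (n + 1), (b i : X)) - ∑ i ∈ Finset.range n, (b i : X) ∈ B n
    rw [Finset.sum_range_succ, add_sub_cancel_left]
    exact (b n).2
  · rfl
  · intro N
    rfl

theorem IsFDD.bijective_partialSumsLimit {X : Type*} [NormedAddCommGroup X] [NormedSpace ℝ X]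
    {B : ℕ → Submodule ℝ X} (hB : IsFDD B) : Function.Bijective (partialSumsLimit B) := by
  constructor
  · rw [injective_iff_map_eq_zero]
    intro f hf
    let b : (n : ℕ) → B n := fun n => ⟨_, f.2.2 n⟩
    have hb : Tendsto (fun N => ∑ n ∈ Finset.range N, (b n : X)) atTop (𝓝 0) := by
      have h := tendsto_partialSums f.1
      rw [show f.1 OnePoint.infty = 0 from hf] at h
      exact h.congr fun N => (sum_range_partialSums f N).symm
    have h0 : b = 0 := (hB.2.2 0).unique hb (by simp)
    ext p
    induction p using OnePoint.rec with
    | infty => exact hf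
    | coe N =>
      rw [← sum_range_partialSums f N]
      exact Finset.sum_eq_zero fun n _ => congrArg Subtype.val (congrFun h0 n)
  · intro x
    obtain ⟨b, hb, -⟩ := hB.2.2 x
    obtain ⟨f, hf, -⟩ := exists_partialSums hb
    exact ⟨f, hf⟩

/-- The partial sum projections of a finite-dimensional decomposition exist and are uniformly
bounded. -/
theorem IsFDD.exists_projections {X : Type*} [NormedAddCommGroup X] [NormedSpace ℝ X]
    [CompleteSpace X] {B : ℕ → Submodule ℝ X} (hB : IsFDD B) :
    ∃ (P : ℕ → X →L[ℝ] X) (K : ℝ), (∀ N x, ‖P N x‖ ≤ K * ‖x‖) ∧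
      (∀ x, Tendsto (fun N => P N x) atTop (𝓝 x)) ∧
      (∀ i N, ∀ x ∈ B i, P N x = if i < N then x else 0) ∧
      (∀ N x, P (N + 1) x - P N x ∈ B N) ∧ ∀ x, P 0 x = 0 := by
  have : CompleteSpace (partialSums B) := (isClosed_partialSums hB.2.1).completeSpace_coe
  let e := ContinuousLinearEquiv.ofBijective (partialSumsLimit B)
    (LinearMap.ker_eq_bot.2 hB.bijective_partialSumsLimit.1)
    (LinearMap.range_eq_top.2 hB.bijective_partialSumsLimit.2)
  have he (f : partialSums B) : e f = partialSumsLimit B f := rfl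
  refine ⟨fun N => ((ContinuousMap.evalCLM ℝ (N : OnePoint ℕ)).comp (partialSums B).subtypeL).comp
    (e.symm : X →L[ℝ] partialSums B), ‖(e.symm : X →L[ℝ] partialSums B)‖, ?_, ?_, ?_, ?_, ?_⟩
  · intro N x
    exact ((e.symm x).1.norm_coe_le_norm _).trans ((e.symm : X →L[ℝ] partialSums B).le_opNorm x)
  · intro x
    have h := tendsto_partialSums (e.symm x).1
    rwa [show (e.symm x).1 OnePoint.infty = x from e.apply_symm_apply x] at h
  · intro i N x hx
    have hs (N : ℕ) : ∑ n ∈ Finset.range N, ((Pi.single i ⟨x, hx⟩ : (n : ℕ) → B n) n : X) =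
        if i < N then x else 0 := by
      have h (n : ℕ) : ((Pi.single i ⟨x, hx⟩ : (n : ℕ) → B n) n : X) = if n = i then x else 0 := by
        by_cases hn : n = i
        · subst hn; simp
        · simp [hn]
      simp [h]
    obtain ⟨f, hf, hfN⟩ := exists_partialSums (b := (Pi.single i ⟨x, hx⟩ : (n : ℕ) → B n)) (x := x)
      (by
        refine tendsto_const_nhds.congr' ?_
        filter_upwards [eventually_gt_atTop i] with N hN
        rw [hs, if_pos hN])
    have hfx : e.symm x = f := by rw [← hf, ← he, e.symm_apply_apply]
    change (e.symm x).1 (N : OnePoint ℕ) = _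
    rw [hfx, hfN, hs]
  · intro N x
    exact (e.symm x).2.2 N
  · intro x
    exact (e.symm x).2.1

section Projections

variable {X : Type*} [AddCommGroup X] [Module ℝ X] {B : ℕ → Submodule ℝ X} {P : ℕ → X →ₗ[ℝ] X}

theorem projection_sub_mem (hd : ∀ N x, P (N + 1) x - P N x ∈ B N) {M N : ℕ} (h : M ≤ N) (x : X) :
    P N x - P M x ∈ ⨆ i ∈ Finset.Ico M N, B i := by
  induction N, h using Nat.le_induction with
  | base => simp
  | succ N hMN ih =>
    rw [← sub_add_sub_cancel (P (N + 1) x) (P N x)]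
    refine add_mem ?_ ((biSup_mono fun i hi => ?_ :
      (⨆ i ∈ Finset.Ico M N, B i) ≤ ⨆ i ∈ Finset.Ico M (N + 1), B i) ih)
    · exact (le_biSup B (Finset.mem_Ico.2 ⟨hMN, N.lt_succ_self⟩)) (hd N x)
    · simp only [Finset.mem_Ico] at hi ⊢
      omega

theorem projection_apply_of_le (hP : ∀ i N, ∀ x ∈ B i, P N x = if i < N then x else 0)
    {a b N : ℕ} (h : b ≤ N) {x : X} (hx : x ∈ ⨆ i ∈ Finset.Ico a b, B i) : P N x = x := by
  have : (⨆ i ∈ Finset.Ico a b, B i) ≤ LinearMap.eqLocus (P N) LinearMap.id := by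
    refine iSup₂_le fun i hi y hy => ?_
    have hi := Finset.mem_Ico.1 hi
    rw [LinearMap.mem_eqLocus, hP i N y hy, if_pos (by omega), LinearMap.id_apply]
  exact this hx

theorem projection_apply_of_ge (hP : ∀ i N, ∀ x ∈ B i, P N x = if i < N then x else 0)
    {a b N : ℕ} (h : N ≤ a) {x : X} (hx : x ∈ ⨆ i ∈ Finset.Ico a b, B i) : P N x = 0 := by
  have : (⨆ i ∈ Finset.Ico a b, B i) ≤ LinearMap.ker (P N) := by
    refine iSup₂_le fun i hi y hy => ?_
    have hi := Finset.mem_Ico.1 hi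
    rw [LinearMap.mem_ker, hP i N y hy, if_neg (by omega)]
  exact this hx

theorem projection_projection (hP : ∀ i N, ∀ x ∈ B i, P N x = if i < N then x else 0)
    (hd : ∀ N x, P (N + 1) x - P N x ∈ B N) (h0 : ∀ x, P 0 x = 0) (N M : ℕ) (x : X) :
    P N (P M x) = P (min N M) x := by
  induction M with
  | zero => simp [h0]
  | succ M ih =>
    have h := hP M N _ (hd M x)
    rw [map_sub, ih, sub_eq_iff_eq_add] at h
    rw [h]
    split_ifs with hMN
    · rw [min_eq_right hMN.le, min_eq_right hMN, sub_add_cancel]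
    · rw [min_eq_left (by omega), min_eq_left (by omega), zero_add]

end Projections

theorem exists_norm_eq_one_of_finiteDimensional_range {Z W : Type*} [NormedAddCommGroup Z]
    [NormedSpace ℝ Z] [AddCommGroup W] [Module ℝ W] (T : Z →ₗ[ℝ] W)
    (hT : FiniteDimensional ℝ (LinearMap.range T)) {U : Submodule ℝ Z}
    (hU : ¬FiniteDimensional ℝ U) : ∃ u ∈ U, ‖u‖ = 1 ∧ T u = 0 := by
  have hker : ∃ u ∈ U, T u = 0 ∧ u ≠ 0 := by
    by_contra! h
    refine hU (FiniteDimensional.of_injective (T.rangeRestrict.domRestrict U) ?_)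
    rw [injective_iff_map_eq_zero]
    intro u hu
    exact Subtype.ext (h u u.2 (congrArg Subtype.val hu))
  obtain ⟨u, huU, hTu, hu⟩ := hker
  exact ⟨‖u‖⁻¹ • u, U.smul_mem _ huU, norm_smul_inv_norm (𝕜 := ℝ) hu,
    by rw [map_smul, hTu, smul_zero]⟩

section Perturbation

variable {Z : Type*} [NormedAddCommGroup Z] [NormedSpace ℝ Z]

theorem coefficient_le {D : ℕ → Z →ₗ[ℝ] Z} {L : ℝ} {w : ℕ → Z} (hL : ∀ n z, ‖D n z‖ ≤ L * ‖z‖)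
    (hD : ∀ n l, D n (w l) = if n = l then w l else 0) (hw : ∀ n, 1 / 2 ≤ ‖w n‖)
    (c : ℕ →₀ ℝ) (n : ℕ) : |c n| ≤ 2 * L * ‖Finsupp.linearCombination ℝ w c‖ := by
  have h : D n (Finsupp.linearCombination ℝ w c) = c n • w n := by
    rw [Finsupp.linearCombination_apply, map_finsuppSum]
    simp only [map_smul, hD, smul_ite, smul_zero]
    rw [Finsupp.sum_ite_eq]
    split_ifs with hn
    · rfl
    · rw [Finsupp.notMem_support_iff.1 hn, zero_smul]
  have h2 := hL n (Finsupp.linearCombination ℝ w c)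
  rw [h, norm_smul, Real.norm_eq_abs] at h2
  nlinarith [hw n, abs_nonneg (c n)]

theorem norm_linearCombination_sub_le {w e : ℕ → Z} {δ : ℕ → ℝ} (hδ : Summable δ)
    (hwe : ∀ n, ‖w n - e n‖ ≤ δ n) {c : ℕ →₀ ℝ} {M : ℝ} (hc : ∀ n, |c n| ≤ M) :
    ‖Finsupp.linearCombination ℝ w c - Finsupp.linearCombination ℝ e c‖ ≤ M * ∑' n, δ n := by
  have hδ0 (n : ℕ) : 0 ≤ δ n := (norm_nonneg _).trans (hwe n)
  have hM : 0 ≤ M := (abs_nonneg _).trans (hc 0)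
  rw [Finsupp.linearCombination_apply, Finsupp.linearCombination_apply, Finsupp.sum, Finsupp.sum,
    ← Finset.sum_sub_distrib]
  calc ‖∑ n ∈ c.support, (c n • w n - c n • e n)‖ ≤ ∑ n ∈ c.support, M * δ n := by
        refine norm_sum_le_of_le _ fun n _ => ?_
        rw [← smul_sub, norm_smul, Real.norm_eq_abs]
        exact mul_le_mul (hc n) (hwe n) (norm_nonneg _) hM
    _ = M * ∑ n ∈ c.support, δ n := by rw [Finset.mul_sum]
    _ ≤ M * ∑' n, δ n := by
        gcongr
        exact hδ.sum_le_tsum _ fun n _ => hδ0 n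

/-- A summable perturbation of two interlaced block sequences preserves the topological direct
sum inequality between their linear spans. -/
theorem exists_norm_le_of_perturbation {D : ℕ → Z →ₗ[ℝ] Z} {L : ℝ} {w e : ℕ → Z} {δ : ℕ → ℝ}
    (hL : ∀ n z, ‖D n z‖ ≤ L * ‖z‖) (hD : ∀ n l, D n (w l) = if n = l then w l else 0)
    (hw : ∀ n, 1 / 2 ≤ ‖w n‖) (hδ : Summable δ) (hwe : ∀ n, ‖w n - e n‖ ≤ δ n)
    {U V : Submodule ℝ Z} (heU : ∀ n, Even n → e n ∈ U) (heV : ∀ n, ¬Even n → e n ∈ V) {C : ℝ}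
    (hC : ∀ u ∈ U, ∀ v ∈ V, ‖u‖ ≤ C * ‖u + v‖) :
    ∃ C' : ℝ, ∀ u ∈ Submodule.span ℝ (w '' {n | Even n}),
      ∀ v ∈ Submodule.span ℝ (w '' {n | ¬Even n}), ‖u‖ ≤ C' * ‖u + v‖ := by
  set S := ∑' n, δ n
  refine ⟨2 * L * S + |C| * (1 + 2 * L * S), fun u hu v hv => ?_⟩
  obtain ⟨a, ha, rfl⟩ := (Finsupp.mem_span_image_iff_linearCombination ℝ).1 hu
  obtain ⟨b, hb, rfl⟩ := (Finsupp.mem_span_image_iff_linearCombination ℝ).1 hv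
  have hmem {s : Set ℕ} {c : ℕ →₀ ℝ} (hc : c ∈ Finsupp.supported ℝ ℝ s) {W : Submodule ℝ Z}
      (hW : ∀ n ∈ s, e n ∈ W) : Finsupp.linearCombination ℝ e c ∈ W :=
    W.sum_mem fun n hn => W.smul_mem _ (hW n (hc hn))
  have hCe := hC _ (hmem ha heU) _ (hmem hb heV)
  rw [← map_add] at hCe ⊢
  set M := 2 * L * ‖Finsupp.linearCombination ℝ w (a + b)‖ with hM
  have hcM (n : ℕ) : |(a + b) n| ≤ M := coefficient_le hL hD hw (a + b) n
  have haM (n : ℕ) : |a n| ≤ M := by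
    by_cases hn : Even n
    · have : b n = 0 := Finsupp.notMem_support_iff.1 fun h => hb h hn
      simpa [this] using hcM n
    · have : a n = 0 := Finsupp.notMem_support_iff.1 fun h => hn (ha h)
      rw [this, abs_zero]
      exact (abs_nonneg _).trans (hcM 0)
  have h1 := norm_linearCombination_sub_le hδ hwe haM
  have h2 := norm_linearCombination_sub_le hδ hwe hcM
  have h3 := norm_le_norm_add_norm_sub' (Finsupp.linearCombination ℝ w a)
    (Finsupp.linearCombination ℝ e a)
  have h4 := norm_le_norm_add_norm_sub' (Finsupp.linearCombination ℝ e (a + b))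
    (Finsupp.linearCombination ℝ w (a + b))
  rw [norm_sub_rev] at h4
  have h5 : C * ‖Finsupp.linearCombination ℝ e (a + b)‖ ≤
      |C| * (‖Finsupp.linearCombination ℝ w (a + b)‖ + M * S) := by
    refine (mul_le_mul_of_nonneg_right (le_abs_self C) (norm_nonneg _)).trans ?_
    exact mul_le_mul_of_nonneg_left (by linarith) (abs_nonneg C)
  calc _ ≤ |C| * (‖Finsupp.linearCombination ℝ w (a + b)‖ + M * S) + M * S := by linarith
    _ = _ := by rw [hM]; ring

/-- Inside two infinite-dimensional subspaces with the topological direct sum inequality one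
finds, up to a perturbation, alternating block sequences with respect to projections `T`. -/
theorem exists_alternating_blocks {T : ℕ → Z →ₗ[ℝ] Z} {K : ℝ} (hK : ∀ n z, ‖T n z‖ ≤ K * ‖z‖)
    (hlim : ∀ z, Tendsto (fun n => T n z) atTop (𝓝 z))
    (hmin : ∀ m n z, T m (T n z) = T (min m n) z)
    (hfin : ∀ n, FiniteDimensional ℝ (LinearMap.range (T n))) {U V : Submodule ℝ Z}
    (hU : ¬FiniteDimensional ℝ U) (hV : ¬FiniteDimensional ℝ V) {C : ℝ}
    (hC : ∀ u ∈ U, ∀ v ∈ V, ‖u‖ ≤ C * ‖u + v‖) :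
    ∃ m : ℕ → ℕ, StrictMono m ∧ m 0 = 0 ∧ ∃ w : ℕ → Z,
      (∀ n, T (m (n + 1)) (w n) = w n) ∧ (∀ n, T (m n) (w n) = 0) ∧ LinearIndependent ℝ w ∧
      ∃ C' : ℝ, ∀ u ∈ Submodule.span ℝ (w '' {n | Even n}),
        ∀ v ∈ Submodule.span ℝ (w '' {n | ¬Even n}), ‖u‖ ≤ C' * ‖u + v‖ := by
  have hstep (n m : ℕ) : ∃ m' > m, ∃ e : Z, (Even n → e ∈ U) ∧ (¬Even n → e ∈ V) ∧ ‖e‖ = 1 ∧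
      T m e = 0 ∧ ‖T m' e - e‖ ≤ 1 / 2 * (1 / 2 : ℝ) ^ n := by
    have he : ∃ e : Z, (Even n → e ∈ U) ∧ (¬Even n → e ∈ V) ∧ ‖e‖ = 1 ∧ T m e = 0 := by
      by_cases hn : Even n
      · obtain ⟨e, he, h⟩ := exists_norm_eq_one_of_finiteDimensional_range (T m) (hfin m) hU
        exact ⟨e, fun _ => he, fun h => absurd hn h, h⟩
      · obtain ⟨e, he, h⟩ := exists_norm_eq_one_of_finiteDimensional_range (T m) (hfin m) hV
        exact ⟨e, fun h => absurd h hn, fun _ => he, h⟩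
    obtain ⟨e, heU, heV, he1, he0⟩ := he
    have hev := (Metric.tendsto_nhds.1 (hlim e) (1 / 2 * (1 / 2 : ℝ) ^ n) (by positivity)).and
      (eventually_gt_atTop m)
    obtain ⟨m', hm', hgt⟩ := hev.exists
    exact ⟨m', hgt, e, heU, heV, he1, he0, by rw [← dist_eq_norm]; exact hm'.le⟩
  choose next hnext vec hvU hvV hv1 hv0 hvT using hstep
  let m : ℕ → ℕ := fun n => Nat.rec 0 (fun n r => next n r) n
  have hm : StrictMono m := strictMono_nat_of_lt_succ fun n => hnext n (m n)
  let e : ℕ → Z := fun n => vec n (m n)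
  let w : ℕ → Z := fun n => T (m (n + 1)) (e n)
  have hwe (n : ℕ) : ‖w n - e n‖ ≤ 1 / 2 * (1 / 2 : ℝ) ^ n := hvT n (m n)
  have hw (n : ℕ) : 1 / 2 ≤ ‖w n‖ := by
    have h1 := norm_le_norm_add_norm_sub' (e n) (w n)
    have h2 : ‖e n‖ = 1 := hv1 n (m n)
    have h3 := hwe n
    have h4 : (1 / 2 : ℝ) ^ n ≤ 1 := pow_le_one₀ (by norm_num) (by norm_num)
    rw [norm_sub_rev] at h1
    linarith
  have hTe (n : ℕ) : T (m n) (e n) = 0 := hv0 n (m n)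
  have hT_ge {n l : ℕ} (h : l < n) : T (m n) (w l) = w l := by
    change T _ (T _ _) = T _ _
    rw [hmin, min_eq_right (hm.monotone h)]
  have hT_le {n l : ℕ} (h : n ≤ l) : T (m n) (w l) = 0 := by
    change T _ (T _ _) = 0
    rw [hmin, min_eq_left (hm.monotone (h.trans l.le_succ)), ← min_eq_left (hm.monotone h), ← hmin,
      hTe, map_zero]
  let D : ℕ → Z →ₗ[ℝ] Z := fun n => T (m (n + 1)) - T (m n)
  have hDL (n : ℕ) (z : Z) : ‖D n z‖ ≤ 2 * K * ‖z‖ := by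
    have h := norm_sub_le (T (m (n + 1)) z) (T (m n) z)
    have h1 := hK (m (n + 1)) z
    have h2 := hK (m n) z
    change ‖T (m (n + 1)) z - T (m n) z‖ ≤ _
    linarith
  have hDw (n l : ℕ) : D n (w l) = if n = l then w l else 0 := by
    change T (m (n + 1)) (w l) - T (m n) (w l) = _
    rcases lt_trichotomy n l with h | rfl | h
    · rw [hT_le h, hT_le h.le, if_neg h.ne, sub_zero]
    · rw [hT_ge n.lt_succ_self, hT_le le_rfl, if_pos rfl, sub_zero]
    · rw [hT_ge h, hT_ge (h.trans n.lt_succ_self), if_neg h.ne', sub_self]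
  refine ⟨m, hm, rfl, w, fun n => hT_ge n.lt_succ_self, fun n => hT_le le_rfl, ?_,
    exists_norm_le_of_perturbation hDL hDw hw
      ((summable_geometric_of_lt_one (by norm_num) (by norm_num)).mul_left (1 / 2 : ℝ)) hwe
      (fun n => hvU n (m n)) (fun n => hvV n (m n)) hC⟩
  rw [linearIndependent_iff]
  intro c hc
  ext n
  have h := coefficient_le hDL hDw hw c n
  rw [hc, norm_zero, mul_zero] at h
  exact abs_nonpos_iff.1 h

end Perturbation

section TopDirectSum

theorem not_finiteDimensional_of_linearIndependent {Z : Type*} [AddCommGroup Z] [Module ℝ Z]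
    {w : ℕ → Z} (hw : LinearIndependent ℝ w) {S : Submodule ℝ Z} (hS : ∀ n, w n ∈ S) :
    ¬FiniteDimensional ℝ S := by
  intro h
  have hli : LinearIndependent ℝ fun n => (⟨w n, hS n⟩ : S) :=
    LinearIndependent.of_comp S.subtype hw
  exact not_finite_iff_infinite.2 (inferInstance : Infinite ℕ) hli.finite

theorem map_topologicalClosure_le_topologicalClosure {X Z : Type*} [SeminormedAddCommGroup X]
    [NormedSpace ℝ X] [SeminormedAddCommGroup Z] [NormedSpace ℝ Z] {f : X →ₗ[ℝ] Z}
    (hf : Continuous f) {A : Submodule ℝ X} {N : Submodule ℝ Z} (h : A.map f ≤ N) :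
    A.topologicalClosure.map f ≤ N.topologicalClosure := by
  rw [Submodule.map_le_iff_le_comap] at h ⊢
  exact A.topologicalClosure_minimal (h.trans (Submodule.comap_mono N.le_topologicalClosure))
    (N.isClosed_topologicalClosure.preimage hf)

theorem norm_le_of_mem_topologicalClosure {Z : Type*} [SeminormedAddCommGroup Z] [NormedSpace ℝ Z]
    {U V : Submodule ℝ Z} {C : ℝ} (hC : ∀ u ∈ U, ∀ v ∈ V, ‖u‖ ≤ C * ‖u + v‖) {u v : Z}
    (hu : u ∈ U.topologicalClosure) (hv : v ∈ V.topologicalClosure) : ‖u‖ ≤ C * ‖u + v‖ := by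
  have huv : (u, v) ∈ closure ((U : Set Z) ×ˢ (V : Set Z)) := by
    rw [closure_prod_eq]
    exact ⟨hu, hv⟩
  have hcl : IsClosed {p : Z × Z | ‖p.1‖ ≤ C * ‖p.1 + p.2‖} :=
    isClosed_le (by fun_prop) (by fun_prop)
  exact closure_minimal (fun p hp => hC p.1 hp.1 p.2 hp.2) hcl huv

theorem isTopDirectSum_of_norm_le {Z : Type*} [NormedAddCommGroup Z] [NormedSpace ℝ Z]
    [CompleteSpace Z] {U V : Submodule ℝ Z} (hU : IsClosed (U : Set Z)) (hV : IsClosed (V : Set Z))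
    {C : ℝ} (hC : ∀ u ∈ U, ∀ v ∈ V, ‖u‖ ≤ C * ‖u + v‖) : IsTopDirectSum U V := by
  refine ⟨?_, ?_, C, hC⟩
  · rw [Submodule.eq_bot_iff]
    rintro x ⟨hxU, hxV⟩
    have h := hC x hxU (-x) (V.neg_mem hxV)
    rw [add_neg_cancel, norm_zero, mul_zero] at h
    exact norm_le_zero_iff.1 h
  · have : CompleteSpace U := hU.completeSpace_coe
    have : CompleteSpace V := hV.completeSpace_coe
    have hanti : AntilipschitzWith (Real.toNNReal (|C| + 1)) (U.subtypeL.coprod V.subtypeL) := by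
      refine ContinuousLinearMap.antilipschitz_of_bound _ fun p => ?_
      rw [Real.coe_toNNReal _ (by positivity)]
      change max ‖(p.1 : Z)‖ ‖(p.2 : Z)‖ ≤ (|C| + 1) * ‖(p.1 : Z) + p.2‖
      have h1 := hC p.1 p.1.2 p.2 p.2.2
      have h2 : C * ‖(p.1 : Z) + p.2‖ ≤ |C| * ‖(p.1 : Z) + p.2‖ :=
        mul_le_mul_of_nonneg_right (le_abs_self C) (norm_nonneg _)
      have h3 := norm_sub_le ((p.1 : Z) + p.2) p.1
      rw [add_sub_cancel_left] at h3
      have h4 := norm_nonneg ((p.1 : Z) + p.2)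
      exact max_le (by linarith) (by linarith)
    have hcl := hanti.isClosed_range (U.subtypeL.coprod V.subtypeL).uniformContinuous
    convert hcl using 1
    ext x
    simp [Submodule.mem_sup]

/-- A space is decomposable as soon as its image under an isometric embedding is the topological
direct sum of two infinite-dimensional closed subspaces. -/
theorem Decomposable.of_isometry {E Z : Type*} [SeminormedAddCommGroup E] [NormedSpace ℝ E]
    [SeminormedAddCommGroup Z] [NormedSpace ℝ Z] {φ : E →ₗ[ℝ] Z} (hφ : ∀ x, ‖φ x‖ = ‖x‖)
    (hinj : Function.Injective φ) {U V : Submodule ℝ Z} (hUc : IsClosed (U : Set Z))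
    (hVc : IsClosed (V : Set Z)) (hU : ¬FiniteDimensional ℝ U) (hV : ¬FiniteDimensional ℝ V)
    (hsup : U ⊔ V = LinearMap.range φ) (h : IsTopDirectSum U V) : Decomposable E := by
  have hcont : Continuous φ := (AddMonoidHomClass.isometry_of_norm φ hφ).continuous
  have hfin {W : Submodule ℝ Z} (hW : ¬FiniteDimensional ℝ W) (hle : W ≤ LinearMap.range φ) :
      ¬FiniteDimensional ℝ (W.comap φ) := by
    intro h
    rw [← Submodule.map_comap_eq_self hle] at hW
    exact hW inferInstance
  have hsup' : U.comap φ ⊔ V.comap φ = ⊤ := by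
    rw [eq_top_iff]
    intro x _
    have hx : φ x ∈ U ⊔ V := hsup ▸ LinearMap.mem_range_self φ x
    obtain ⟨u, hu, v, hv, huv⟩ := Submodule.mem_sup.1 hx
    obtain ⟨a, rfl⟩ := (le_sup_left.trans hsup.le) hu
    obtain ⟨b, rfl⟩ := (le_sup_right.trans hsup.le) hv
    rw [← map_add] at huv
    rw [← hinj huv]
    exact Submodule.add_mem_sup hu hv
  refine ⟨U.comap φ, V.comap φ, hUc.preimage hcont, hVc.preimage hcont,
    hfin hU (le_sup_left.trans hsup.le), hfin hV (le_sup_right.trans hsup.le), hsup', ?_, ?_, ?_⟩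
  · rw [← Submodule.comap_inf, h.1, Submodule.comap_bot, LinearMap.ker_eq_bot.2 hinj]
  · rw [hsup']
    exact isClosed_univ
  · obtain ⟨C, hC⟩ := h.2.2
    refine ⟨C, fun u hu v hv => ?_⟩
    rw [← hφ u, ← hφ (u + v), map_add]
    exact hC _ hu _ hv

theorem Decomposable.congr {E E' : Type*} [SeminormedAddCommGroup E] [NormedSpace ℝ E]
    [SeminormedAddCommGroup E'] [NormedSpace ℝ E'] (e : E ≃ₗᵢ[ℝ] E') (h : Decomposable E) :
    Decomposable E' := by
  obtain ⟨U, V, hUc, hVc, hU, hV, hsup, hUV⟩ := h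
  exact .of_isometry (φ := e.symm.toLinearEquiv.toLinearMap) e.symm.norm_map e.symm.injective
    hUc hVc hU hV (by rw [hsup, LinearEquiv.range]) hUV

end TopDirectSum

section Quotient

variable {X : Type*} [SeminormedAddCommGroup X] [NormedSpace ℝ X]

/-- The quotient `A / Y` of a subspace `A ⊇ Y` is isometric to the image of `A` in `X / Y`. -/
def quotientEquivMap {A Y : Submodule ℝ X} (h : Y ≤ A) :
    (A ⧸ Y.comap A.subtype) ≃ₗᵢ[ℝ] A.map Y.mkQ where
  toLinearEquiv := LinearEquiv.ofBijective
    ((Submodule.mapQ (Y.comap A.subtype) Y A.subtype le_rfl).codRestrict (A.map Y.mkQ) (by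
      intro z
      induction z using Submodule.Quotient.induction_on with
      | _ a => exact ⟨a, a.2, rfl⟩)) (by
      constructor
      · rw [injective_iff_map_eq_zero]
        intro z hz
        induction z using Submodule.Quotient.induction_on with
        | _ a =>
          rw [Submodule.Quotient.mk_eq_zero]
          exact (Submodule.Quotient.mk_eq_zero Y).1 (congrArg Subtype.val hz)
      · rintro ⟨_, a, ha, rfl⟩
        exact ⟨Submodule.Quotient.mk ⟨a, ha⟩, rfl⟩)
  norm_map' z := by
    induction z using Submodule.Quotient.induction_on with
    | _ a =>
      change ‖(Submodule.Quotient.mk (a : X) : X ⧸ Y)‖ = _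
      have h1 : ‖(Submodule.Quotient.mk (a : X) : X ⧸ Y)‖ = Metric.infDist (a : X) Y :=
        QuotientAddGroup.norm_mk (S := Y.toAddSubgroup) (a : X)
      have h2 : ‖(Submodule.Quotient.mk a : A ⧸ Y.comap A.subtype)‖ =
          Metric.infDist a (Y.comap A.subtype : Set A) :=
        QuotientAddGroup.norm_mk (S := (Y.comap A.subtype).toAddSubgroup) a
      have h3 : ((↑) : A → X) '' (Y.comap A.subtype : Set A) = Y := by
        ext y
        exact ⟨by rintro ⟨b, hb, rfl⟩; exact hb, fun hy => ⟨⟨y, h hy⟩, hy, rfl⟩⟩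
      rw [h1, h2, ← h3]
      exact Metric.infDist_image isometry_subtype_coe

theorem isClosed_map_mkQ {A Y : Submodule ℝ X} (h : Y ≤ A) (hA : IsClosed (A : Set X)) :
    IsClosed (A.map Y.mkQ : Set (X ⧸ Y)) := by
  rw [← Y.isQuotientMap_mkQ.isClosed_preimage]
  convert hA using 1
  change ((A.map Y.mkQ).comap Y.mkQ : Set X) = A
  rw [Submodule.comap_map_mkQ, sup_eq_right.2 h]

theorem finiteDimensional_fddQS_iff {F G : ℕ → Submodule ℝ X} (h : ∀ n, G n ≤ F n) :
    FiniteDimensional ℝ (fddQS F G) ↔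
      FiniteDimensional ℝ
        (((⨆ n, F n).topologicalClosure).map ((⨆ n, G n).topologicalClosure).mkQ) :=
  Module.Finite.equiv_iff
    (quotientEquivMap (Submodule.topologicalClosure_mono (iSup_mono h))).toLinearEquiv

theorem map_mkQ_topologicalClosure_sup {Y : Submodule ℝ X} {F F' : ℕ → Submodule ℝ X}
    (h : IsClosed (((⨆ n, F n).topologicalClosure.map Y.mkQ ⊔
      (⨆ n, F' n).topologicalClosure.map Y.mkQ : Submodule ℝ (X ⧸ Y)) : Set (X ⧸ Y))) :
    (⨆ n, F n).topologicalClosure.map Y.mkQ ⊔ (⨆ n, F' n).topologicalClosure.map Y.mkQ =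
      (⨆ n, F n ⊔ F' n).topologicalClosure.map Y.mkQ := by
  apply le_antisymm
  · refine sup_le (Submodule.map_mono (Submodule.topologicalClosure_mono ?_))
      (Submodule.map_mono (Submodule.topologicalClosure_mono ?_))
    · exact iSup_mono fun n => le_sup_left
    · exact iSup_mono fun n => le_sup_right
  · rw [Submodule.map_le_iff_le_comap]
    refine Submodule.topologicalClosure_minimal _ ?_ (h.preimage Y.isQuotientMap_mkQ.continuous)
    rw [iSup_sup_eq]
    refine sup_le ?_ ?_
    · refine (Submodule.le_topologicalClosure _).trans ?_
      rw [← Submodule.map_le_iff_le_comap]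
      exact le_sup_left
    · refine (Submodule.le_topologicalClosure _).trans ?_
      rw [← Submodule.map_le_iff_le_comap]
      exact le_sup_right

theorem norm_mapQ_le {Y : Submodule ℝ X} {P : X →ₗ[ℝ] X} (hY : Y ≤ Y.comap P) {K : ℝ}
    (hK : ∀ x, ‖P x‖ ≤ K * ‖x‖) (z : X ⧸ Y) : ‖Y.mapQ Y P hY z‖ ≤ |K| * ‖z‖ := by
  have ht : Tendsto (fun t => |K| * t) (𝓝[>] ‖z‖) (𝓝 (|K| * ‖z‖)) :=
    (by fun_prop : Continuous fun t => |K| * t).continuousWithinAt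
  refine ge_of_tendsto ht ?_
  filter_upwards [self_mem_nhdsWithin] with t ht
  obtain ⟨x, rfl, hx⟩ := Submodule.Quotient.norm_mk_lt z (sub_pos.2 ht)
  rw [add_sub_cancel] at hx
  calc ‖Y.mapQ Y P hY (Submodule.Quotient.mk x)‖ ≤ ‖P x‖ := Submodule.Quotient.norm_mk_le Y (P x)
    _ ≤ K * ‖x‖ := hK x
    _ ≤ |K| * t := mul_le_mul (le_abs_self K) hx.le (norm_nonneg x) (abs_nonneg K)

end Quotient

section Blocks

theorem SuccPartition.exists_mem_Ico {q : ℕ → ℕ} (hq : SuccPartition q) (n : ℕ) :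
    ∃ j, n ∈ Finset.Ico (q j) (q (j + 1)) := by
  have h (N : ℕ) (hN : n < q N) : ∃ j, n ∈ Finset.Ico (q j) (q (j + 1)) := by
    induction N with
    | zero => exact absurd hN (by simp [hq.2])
    | succ N ih =>
      by_cases hn : n < q N
      · exact ih hn
      · exact ⟨N, Finset.mem_Ico.2 ⟨not_lt.1 hn, hN⟩⟩
  exact h (n + 1) (hq.1.le_apply)

theorem SuccPartition.comp {k q : ℕ → ℕ} (hk : SuccPartition k) (hq : SuccPartition q) :
    SuccPartition (k ∘ q) :=
  ⟨hk.1.comp hq.1, by rw [Function.comp_apply, hq.2, hk.2]⟩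

theorem iSup_biSup_Ico_eq {α : Type*} [CompleteLattice α] {q : ℕ → ℕ} (hq : SuccPartition q)
    (G : ℕ → α) : ⨆ j, ⨆ n ∈ Finset.Ico (q j) (q (j + 1)), G n = ⨆ n, G n := by
  refine le_antisymm (iSup_le fun j => iSup₂_le fun n _ => le_iSup G n) (iSup_le fun n => ?_)
  obtain ⟨j, hj⟩ := hq.exists_mem_Ico n
  exact (le_biSup G hj).trans (le_iSup (fun j => ⨆ n ∈ Finset.Ico (q j) (q (j + 1)), G n) j)

theorem biSup_Ico_mono {α : Type*} [CompleteLattice α] (B : ℕ → α) {a b c d : ℕ} (hac : c ≤ a)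
    (hbd : b ≤ d) : ⨆ i ∈ Finset.Ico a b, B i ≤ ⨆ i ∈ Finset.Ico c d, B i :=
  biSup_mono fun _ hi => Finset.Ico_subset_Ico hac hbd hi

theorem biSup_Ico_le_biSup_Ico {α : Type*} [CompleteLattice α] {B G : ℕ → α} {k : ℕ → ℕ}
    (hk : Monotone k) (hG : ∀ n, G n ≤ ⨆ i ∈ Finset.Ico (k n) (k (n + 1)), B i) (a b : ℕ) :
    ⨆ n ∈ Finset.Ico a b, G n ≤ ⨆ i ∈ Finset.Ico (k a) (k b), B i := by
  refine iSup₂_le fun n hn => (hG n).trans ?_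
  have hn := Finset.mem_Ico.1 hn
  exact biSup_Ico_mono B (hk hn.1) (hk hn.2)

variable {X : Type*} [NormedAddCommGroup X] [NormedSpace ℝ X]

theorem map_topologicalClosure_sup_span_le {G : ℕ → Submodule ℝ X} {x : ℕ → X}
    {N : Submodule ℝ (X ⧸ (⨆ n, G n).topologicalClosure)}
    (hx : ∀ j, (⨆ n, G n).topologicalClosure.mkQ (x j) ∈ N) :
    (⨆ n, G n ⊔ Submodule.span ℝ {x n}).topologicalClosure.map
      (⨆ n, G n).topologicalClosure.mkQ ≤ N.topologicalClosure := by
  refine map_topologicalClosure_le_topologicalClosure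
    (⨆ n, G n).topologicalClosure.isQuotientMap_mkQ.continuous ?_
  rw [Submodule.map_le_iff_le_comap]
  refine iSup_le fun j => sup_le ?_ ?_
  · refine ((le_iSup G j).trans (Submodule.le_topologicalClosure _)).trans fun y hy => ?_
    rw [Submodule.mem_comap, Submodule.mkQ_apply, (Submodule.Quotient.mk_eq_zero _).2 hy]
    exact N.zero_mem
  · rw [Submodule.span_singleton_le_iff_mem]
    exact hx j

theorem not_finiteDimensional_fddQS_sup_span {G : ℕ → Submodule ℝ X} {x : ℕ → X}
    (hx : LinearIndependent ℝ fun j => (⨆ n, G n).topologicalClosure.mkQ (x j)) :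
    ¬FiniteDimensional ℝ (fddQS (fun n => G n ⊔ Submodule.span ℝ {x n}) G) := by
  rw [finiteDimensional_fddQS_iff fun n => le_sup_left]
  refine not_finiteDimensional_of_linearIndependent hx fun j => ⟨x j, ?_, rfl⟩
  refine Submodule.le_topologicalClosure _ (Submodule.mem_iSup_of_mem j ?_)
  exact Submodule.mem_sup_right (Submodule.mem_span_singleton_self (x j))

/-- Infinite-dimensional subspaces of `X / Σ G n` satisfying the topological direct sum inequality
can be replaced by images of block subspaces. -/
theorem exists_block_isTopDirectSum [CompleteSpace X] {B : ℕ → Submodule ℝ X} (hB : IsFDD B)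
    {k : ℕ → ℕ} (hk : SuccPartition k) {G : ℕ → Submodule ℝ X}
    (hG : ∀ n, G n ≤ ⨆ i ∈ Finset.Ico (k n) (k (n + 1)), B i) {Y : Submodule ℝ X}
    (hY : Y = (⨆ n, G n).topologicalClosure) {U V : Submodule ℝ (X ⧸ Y)}
    (hU : ¬FiniteDimensional ℝ U) (hV : ¬FiniteDimensional ℝ V) {C : ℝ}
    (hC : ∀ u ∈ U, ∀ v ∈ V, ‖u‖ ≤ C * ‖u + v‖) :
    ∃ k' : ℕ → ℕ, SuccPartition k' ∧ ∃ F F' G' : ℕ → Submodule ℝ X,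
      (∀ n, G' n ≤ F n) ∧ (∀ n, G' n ≤ F' n) ∧
      (∀ n, F n ≤ ⨆ i ∈ Finset.Ico (k' n) (k' (n + 1)), B i) ∧
      (∀ n, F' n ≤ ⨆ i ∈ Finset.Ico (k' n) (k' (n + 1)), B i) ∧
      ¬FiniteDimensional ℝ (fddQS F G') ∧ ¬FiniteDimensional ℝ (fddQS F' G') ∧
      IsTopDirectSum
        (((⨆ n, F n).topologicalClosure).map ((⨆ n, G' n).topologicalClosure).mkQ)
        (((⨆ n, F' n).topologicalClosure).map ((⨆ n, G' n).topologicalClosure).mkQ) := by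
  obtain ⟨P, K, hK, hlim, hP, hd, h0⟩ := hB.exists_projections
  have hYc : IsClosed (Y : Set X) := hY ▸ Submodule.isClosed_topologicalClosure _
  let Q : ℕ → X →ₗ[ℝ] X := fun N => (P N).toLinearMap
  have hPY (n : ℕ) : Y ≤ Y.comap (Q (k n)) := by
    have hGn : (⨆ n, G n).map (Q (k n)) ≤ ⨆ n, G n := by
      rw [Submodule.map_le_iff_le_comap]
      refine iSup_le fun l y hy => ?_
      rw [Submodule.mem_comap]
      rcases lt_or_ge l n with hl | hl
      · rw [projection_apply_of_le hP (P := Q) (hk.1.monotone hl) (hG l hy)]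
        exact Submodule.mem_iSup_of_mem l hy
      · rw [projection_apply_of_ge hP (P := Q) (hk.1.monotone hl) (hG l hy)]
        exact zero_mem _
    rw [hY, ← Submodule.map_le_iff_le_comap]
    exact map_topologicalClosure_le_topologicalClosure (P (k n)).continuous hGn
  let T : ℕ → (X ⧸ Y) →ₗ[ℝ] (X ⧸ Y) := fun n => Y.mapQ Y (Q (k n)) (hPY n)
  have hT (n : ℕ) (x : X) : T n (Y.mkQ x) = Y.mkQ (P (k n) x) := rfl
  have hTlim (z : X ⧸ Y) : Tendsto (fun n => T n z) atTop (𝓝 z) := by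
    induction z using Submodule.Quotient.induction_on with
    | _ x =>
      exact (Y.isQuotientMap_mkQ.continuous.tendsto x).comp ((hlim x).comp hk.1.tendsto_atTop)
  have hTmin (m n : ℕ) (z : X ⧸ Y) : T m (T n z) = T (min m n) z := by
    induction z using Submodule.Quotient.induction_on with
    | _ x =>
      change Y.mkQ (Q (k m) (Q (k n) x)) = Y.mkQ (Q (k (min m n)) x)
      rw [projection_projection hP (P := Q) hd h0, hk.1.monotone.map_min]
  have hTfin (n : ℕ) : FiniteDimensional ℝ (LinearMap.range (T n)) := by
    have := hB.2.1
    have hfin : FiniteDimensional ℝ (⨆ i ∈ Finset.Ico 0 (k n), B i : Submodule ℝ X) := by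
      rw [← Finset.sup_eq_iSup]
      exact Submodule.finiteDimensional_finset_sup _ B
    refine Submodule.finiteDimensional_of_le
      (S₂ := (⨆ i ∈ Finset.Ico 0 (k n), B i : Submodule ℝ X).map Y.mkQ) ?_
    rintro _ ⟨z, rfl⟩
    induction z using Submodule.Quotient.induction_on with
    | _ x =>
      refine ⟨P (k n) x, ?_, rfl⟩
      have h := projection_sub_mem (P := Q) hd (Nat.zero_le (k n)) x
      rwa [show Q 0 x = 0 from h0 x, sub_zero] at h
  obtain ⟨m, hm, hm0, w, hw1, hw0, hwli, C', hC'⟩ := exists_alternating_blocks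
    (fun n z => norm_mapQ_le (hPY n) (hK (k n)) z) hTlim hTmin hTfin hU hV hC
  have hx (n : ℕ) : ∃ x ∈ ⨆ i ∈ Finset.Ico (k (m n)) (k (m (n + 1))), B i, Y.mkQ x = w n := by
    obtain ⟨x, hx⟩ := Y.mkQ_surjective (w n)
    refine ⟨P (k (m (n + 1))) x - P (k (m n)) x, projection_sub_mem (P := Q) hd
      (hk.1.monotone (hm.monotone n.le_succ)) x, ?_⟩
    rw [map_sub, ← hT, ← hT, hx, hw1, hw0, sub_zero]
  choose x hxB hxw using hx
  have hq : SuccPartition fun j => m (2 * j) :=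
    ⟨fun a b h => hm (by omega), hm0⟩
  obtain ⟨G', hG'⟩ : ∃ G' : ℕ → Submodule ℝ X,
      G' = fun j => ⨆ n ∈ Finset.Ico (m (2 * j)) (m (2 * (j + 1))), G n := ⟨_, rfl⟩
  have hY' : Y = (⨆ j, G' j).topologicalClosure := by
    rw [hY, hG', iSup_biSup_Ico_eq hq]
  have hGB (j : ℕ) : G' j ≤ ⨆ i ∈ Finset.Ico (k (m (2 * j))) (k (m (2 * (j + 1)))), B i :=
    hG' ▸ biSup_Ico_le_biSup_Ico hk.1.monotone hG (m (2 * j)) (m (2 * (j + 1)))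
  refine ⟨_, hk.comp hq, fun j => G' j ⊔ Submodule.span ℝ {x (2 * j)},
    fun j => G' j ⊔ Submodule.span ℝ {x (2 * j + 1)}, G', fun j => le_sup_left,
    fun j => le_sup_left, fun j => sup_le (hGB j) ?_, fun j => sup_le (hGB j) ?_, ?_⟩
  · rw [Submodule.span_singleton_le_iff_mem]
    exact biSup_Ico_mono B le_rfl (hk.1.monotone (hm.monotone (by omega))) (hxB (2 * j))
  · rw [Submodule.span_singleton_le_iff_mem]
    exact biSup_Ico_mono B (hk.1.monotone (hm.monotone (by omega))) le_rfl (hxB (2 * j + 1))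
  clear hY
  subst hY'
  have hclosed (p : ℕ → ℕ) := isClosed_map_mkQ (Submodule.topologicalClosure_mono
    (iSup_mono fun j => (le_sup_left : G' j ≤ G' j ⊔ Submodule.span ℝ {x (p j)})))
    (Submodule.isClosed_topologicalClosure _)
  refine ⟨not_finiteDimensional_fddQS_sup_span ?_, not_finiteDimensional_fddQS_sup_span ?_,
    isTopDirectSum_of_norm_le (C := C') (hclosed fun j => 2 * j) (hclosed fun j => 2 * j + 1)
      fun u hu v hv => norm_le_of_mem_topologicalClosure hC'
        (map_topologicalClosure_sup_span_le (fun j => ?_) hu)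
        (map_topologicalClosure_sup_span_le (fun j => ?_) hv)⟩
  · simp only [hxw]
    exact hwli.comp _ fun a b h => by simpa using h
  · simp only [hxw]
    exact hwli.comp _ fun a b h => by simpa using h
  · rw [hxw]
    exact Submodule.subset_span ⟨2 * j, by simp, rfl⟩
  · rw [hxw]
    exact Submodule.subset_span ⟨2 * j + 1, by simp, rfl⟩

end Blocks

theorem RestrictedQHI.not_isTopDirectSum {X : Type*} [NormedAddCommGroup X] [NormedSpace ℝ X]
    {B : ℕ → Submodule ℝ X} (h : RestrictedQHI B) {k : ℕ → ℕ} (hk : SuccPartition k)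
    {F F' G : ℕ → Submodule ℝ X} (hGF : ∀ n, G n ≤ F n) (hGF' : ∀ n, G n ≤ F' n)
    (hF : ∀ n, F n ≤ ⨆ i ∈ Finset.Ico (k n) (k (n + 1)), B i)
    (hF' : ∀ n, F' n ≤ ⨆ i ∈ Finset.Ico (k n) (k (n + 1)), B i)
    (hfin : ¬FiniteDimensional ℝ (fddQS F G)) (hfin' : ¬FiniteDimensional ℝ (fddQS F' G)) :
    ¬IsTopDirectSum
      (((⨆ n, F n).topologicalClosure).map ((⨆ n, G n).topologicalClosure).mkQ)
      (((⨆ n, F' n).topologicalClosure).map ((⨆ n, G n).topologicalClosure).mkQ) := by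
  intro hsum
  have hGS (n : ℕ) : G n ≤ F n ⊔ F' n := (hGF n).trans le_sup_left
  have hmap := map_mkQ_topologicalClosure_sup hsum.2.1
  rw [finiteDimensional_fddQS_iff hGF] at hfin
  rw [finiteDimensional_fddQS_iff hGF'] at hfin'
  refine h k hk (fun n => F n ⊔ F' n) G hGS (fun n => sup_le (hF n) (hF' n)) ?_ ?_
  · rw [finiteDimensional_fddQS_iff hGS, ← hmap]
    exact fun _ => hfin (Submodule.finiteDimensional_of_le
      (le_sup_left (b := (⨆ n, F' n).topologicalClosure.map (⨆ n, G n).topologicalClosure.mkQ)))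
  · refine Decomposable.congr (quotientEquivMap
      (Submodule.topologicalClosure_mono (iSup_mono hGS))).symm ?_
    exact .of_isometry (φ := Submodule.subtype _) (fun _ => rfl) (Submodule.subtype_injective _)
      (isClosed_map_mkQ (Submodule.topologicalClosure_mono (iSup_mono hGF))
        (Submodule.isClosed_topologicalClosure _))
      (isClosed_map_mkQ (Submodule.topologicalClosure_mono (iSup_mono hGF'))
        (Submodule.isClosed_topologicalClosure _))
      hfin hfin' (by rw [hmap, Submodule.range_subtype]) hsum

theorem restrictedQHI_of_isHI {X : Type*} [NormedAddCommGroup X] [NormedSpace ℝ X]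
    {B : ℕ → Submodule ℝ X} (h : ∀ Y : Submodule ℝ X, IsFDDBlockSubspace B Y →
      ¬FiniteDimensional ℝ (X ⧸ Y) → IsHI (X ⧸ Y)) : RestrictedQHI B := by
  intro k hk F G hGF hF hfin hdec
  have hle := Submodule.topologicalClosure_mono (iSup_mono hGF)
  rw [finiteDimensional_fddQS_iff hGF] at hfin
  have hHI := h (⨆ n, G n).topologicalClosure
    ⟨k, hk, G, fun n => (hGF n).trans (hF n), rfl⟩ fun _ => hfin inferInstance
  exact hHI.2 _ (isClosed_map_mkQ hle (Submodule.isClosed_topologicalClosure _))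
    (hdec.congr (quotientEquivMap hle))

theorem isHI_of_not_isTopDirectSum {X : Type*} [NormedAddCommGroup X] [NormedSpace ℝ X]
    [CompleteSpace X] {B : ℕ → Submodule ℝ X} (hB : IsFDD B)
    (h : ∀ k : ℕ → ℕ, SuccPartition k → ∀ F F' G : ℕ → Submodule ℝ X,
      (∀ n, G n ≤ F n) → (∀ n, G n ≤ F' n) →
      (∀ n, F n ≤ ⨆ i ∈ Finset.Ico (k n) (k (n + 1)), B i) →
      (∀ n, F' n ≤ ⨆ i ∈ Finset.Ico (k n) (k (n + 1)), B i) →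
      ¬FiniteDimensional ℝ (fddQS F G) → ¬FiniteDimensional ℝ (fddQS F' G) →
      ¬IsTopDirectSum
        (((⨆ n, F n).topologicalClosure).map ((⨆ n, G n).topologicalClosure).mkQ)
        (((⨆ n, F' n).topologicalClosure).map ((⨆ n, G n).topologicalClosure).mkQ))
    {Y : Submodule ℝ X} (hY : IsFDDBlockSubspace B Y) (hfin : ¬FiniteDimensional ℝ (X ⧸ Y)) :
    IsHI (X ⧸ Y) := by
  obtain ⟨k, hk, G, hG, hYG⟩ := hY
  refine ⟨hfin, ?_⟩
  rintro W - ⟨U, V, -, -, hU, hV, -, -, -, C, hC⟩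
  have hmap {S : Submodule ℝ W} (hS : ¬FiniteDimensional ℝ S) :
      ¬FiniteDimensional ℝ (S.map W.subtype) := fun _ =>
    hS (Module.Finite.equiv (S.equivMapOfInjective W.subtype W.subtype_injective).symm)
  obtain ⟨k', hk', F, F', G', h1, h2, h3, h4, h5, h6, h7⟩ :=
    exists_block_isTopDirectSum hB hk hG hYG (hmap hU) (hmap hV) (C := C) (by
      rintro _ ⟨u, hu, rfl⟩ _ ⟨v, hv, rfl⟩
      exact hC u hu v hv)
  exact h k' hk' F F' G' h1 h2 h3 h4 h5 h6 h7

/-- Proposition: for a Banach space `X` with a finite-dimensional decomposition `B`,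
the following are equivalent:
(i) no infinite-dimensional FDD-block quotient of subspace of `X` is decomposable
    (the restricted QHI property);
(ii) for every infinite-codimensional FDD-block subspace `Y`, the quotient `X/Y` is
    hereditarily indecomposable;
(iii) whenever `Σ F n / Σ G n` and `Σ F' n / Σ G n` are infinite-dimensional FDD-block
    quotients of subspaces with the same successive partition and the same `G n`, their
    images in `X / Σ G n` do not form a topological direct sum. -/
theorem restrictedQHI_equivalences (X : Type*) [NormedAddCommGroup X] [NormedSpace ℝ X]
    [CompleteSpace X] (B : ℕ → Submodule ℝ X) (hB : IsFDD B) :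
    (RestrictedQHI B ↔
      (∀ Y : Submodule ℝ X, IsFDDBlockSubspace B Y →
        ¬FiniteDimensional ℝ (X ⧸ Y) → IsHI (X ⧸ Y))) ∧
    (RestrictedQHI B ↔
      (∀ k : ℕ → ℕ, SuccPartition k →
        ∀ F F' G : ℕ → Submodule ℝ X,
          (∀ n, G n ≤ F n) → (∀ n, G n ≤ F' n) →
          (∀ n, F n ≤ ⨆ i ∈ Finset.Ico (k n) (k (n + 1)), B i) →
          (∀ n, F' n ≤ ⨆ i ∈ Finset.Ico (k n) (k (n + 1)), B i) →
          ¬FiniteDimensional ℝ (fddQS F G) → ¬FiniteDimensional ℝ (fddQS F' G) →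
          ¬ IsTopDirectSum
            (((⨆ n, F n).topologicalClosure).map ((⨆ n, G n).topologicalClosure).mkQ)
            (((⨆ n, F' n).topologicalClosure).map ((⨆ n, G n).topologicalClosure).mkQ))) := by
  have hHI := isHI_of_not_isTopDirectSum hB
  refine ⟨⟨fun h Y hY hfin => hHI (fun k hk F F' G => h.not_isTopDirectSum hk) hY hfin,
      restrictedQHI_of_isHI⟩, fun h k hk F F' G => h.not_isTopDirectSum hk,
    fun h => restrictedQHI_of_isHI fun Y hY hfin => hHI h hY hfin⟩

end
end
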